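/- arXiv:1309.0253 — 3 statements merged into one kernel-verified Lean document; each statement's English description precedes it below -/
import Mathlib

section
/- Let 0 < p ≤ 1. An analytic function f on the unit disk D belongs to Q_p if and only if the measure |f'(z)|^2 (1 - |z|^2)^p dA(z) is a p-Carleson measure on D. -/
open MeasureTheory Complex Metric Set Filter
open scoped ENNReal Real

noncomputable section

/-- The open unit disk in `ℂ`. -/
def unitDisk : Set ℂ := Metric.ball 0 1

/-- The Möbius automorphism `φ_a(z) = (a - z)/(1 - ā z)` of the unit disk. -/
def moebius (a z : ℂ) : ℂ := (a - z) / (1 - (starRingEnd ℂ) a * z)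

/-- Membership in `H^∞(𝔻)`: bounded analytic functions on the unit disk. -/
def MemHinf (f : ℂ → ℂ) : Prop :=
  DifferentiableOn ℂ f unitDisk ∧ ∃ M : ℝ, ∀ z ∈ unitDisk, ‖f z‖ ≤ M

/-- The integral `∫_𝔻 |f'(z)|² (1 - |φ_a(z)|²)^p dA(z)`. -/
def qpIntegral (p : ℝ) (f : ℂ → ℂ) (a : ℂ) : ℝ≥0∞ :=
  ∫⁻ z in unitDisk, ENNReal.ofReal (‖deriv f z‖ ^ 2 * (1 - ‖moebius a z‖ ^ 2) ^ p)

/-- Finiteness of the `H²`-part of the `Q_p` norm: the integrals of `|f|²` over circles of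
radius `r < 1` are uniformly bounded (equivalently, the boundary integral `∫ |f|² dσ`
is finite). -/
def h2Bounded (f : ℂ → ℂ) : Prop :=
  ∃ M : ℝ, ∀ r ∈ Set.Ico (0 : ℝ) 1,
    (∫ t in (0 : ℝ)..(2 * Real.pi), ‖f ((r : ℂ) * Complex.exp (Complex.I * t))‖ ^ 2) ≤ M

/-- Membership in the space `Q_p`: `f` is analytic on the unit disk and
`‖f‖_{Q_p}² = ∫_𝕋 |f|² dσ + sup_{a ∈ 𝔻} ∫_𝔻 |f'(z)|² (1 - |φ_a(z)|²)^p dA(z) < ∞`. -/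
def MemQp (p : ℝ) (f : ℂ → ℂ) : Prop :=
  DifferentiableOn ℂ f unitDisk ∧ h2Bounded f ∧
    ∃ C : ℝ, ∀ a ∈ unitDisk, qpIntegral p f a ≤ ENNReal.ofReal C

/-- The multiplier algebra `M(Q_p)`. -/
def MemMQp (p : ℝ) (φ : ℂ → ℂ) : Prop :=
  MemQp p φ ∧ ∀ f : ℂ → ℂ, MemQp p f → MemQp p (fun z => φ z * f z)

/-- The Carleson square `S(I)` over the arc of the unit circle centered at `e^{iθ}` with
normalized length `h`. -/
def carlesonBox (θ h : ℝ) : Set ℂ :=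
  {z : ℂ | 1 - h < ‖z‖ ∧ ‖z‖ < 1 ∧
    ∃ t : ℝ, |t - θ| < Real.pi * h ∧ z = (‖z‖ : ℂ) * Complex.exp (Complex.I * t)}

/-- A measure `μ` on the unit disk is a `p`-Carleson measure if `μ(S(I)) ≤ C |I|^p`
for every arc `I` of the unit circle. -/
def IsPCarleson (p : ℝ) (μ : Measure ℂ) : Prop :=
  ∃ C : ℝ, ∀ θ : ℝ, ∀ h ∈ Set.Ioc (0 : ℝ) 1,
    μ (carlesonBox θ h) ≤ ENNReal.ofReal (C * h ^ p)

/-- The `p`-Carleson constant `‖μ‖_p = sup_{I ⊂ 𝕋} μ(S(I))/|I|^p`. -/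
def pCarlesonNorm (p : ℝ) (μ : Measure ℂ) : ℝ≥0∞ :=
  ⨆ (θ : ℝ) (h : ℝ) (_ : h ∈ Set.Ioc (0 : ℝ) 1),
    μ (carlesonBox θ h) / ENNReal.ofReal (h ^ p)

/-- The measure `w(z) dA(z)` on the unit disk. -/
def diskMeasure (w : ℂ → ℝ) : Measure ℂ :=
  (volume.restrict unitDisk).withDensity fun z => ENNReal.ofReal (w z)

/-- The Wirtinger derivative `∂F/∂z`. -/
def wderiv (F : ℂ → ℂ) (z : ℂ) : ℂ :=
  (fderiv ℝ F z 1 - Complex.I * fderiv ℝ F z Complex.I) / 2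

/-- The Wirtinger derivative `∂F/∂z̄`. -/
def wderivBar (F : ℂ → ℂ) (z : ℂ) : ℂ :=
  (fderiv ℝ F z 1 + Complex.I * fderiv ℝ F z Complex.I) / 2

/-- The squared length of the (real) gradient: `|∇F|² = 2|∂F/∂z|² + 2|∂F/∂z̄|²`. -/
def gradSq (F : ℂ → ℂ) (z : ℂ) : ℝ :=
  2 * ‖wderiv F z‖ ^ 2 + 2 * ‖wderivBar F z‖ ^ 2

/-- The arc of the unit circle centered at `e^{iθ}` of normalized length `h`, parametrized
by angle. -/
def arcInterval (θ h : ℝ) : Set ℝ := Set.Ioo (θ - Real.pi * h) (θ + Real.pi * h)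

/-- The double integral `∫_I ∫_I |f(ξ) - f(η)|²/|ξ - η|^{2-p} |dξ| |dη|` over the arc
centered at `e^{iθ}` of normalized length `h`. -/
def qpTDouble (p : ℝ) (f : ℝ → ℂ) (θ h : ℝ) : ℝ≥0∞ :=
  ∫⁻ s in arcInterval θ h, ∫⁻ u in arcInterval θ h,
    ENNReal.ofReal (‖f s - f u‖ ^ 2 /
      ‖Complex.exp (Complex.I * s) - Complex.exp (Complex.I * u)‖ ^ (2 - p))

/-- The integral `∫_𝕋 |f|² dσ` of a function on the unit circle (parametrized by angle). -/
def l2Circle (f : ℝ → ℂ) : ℝ≥0∞ :=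
  ∫⁻ t in Set.Ioc (0 : ℝ) (2 * Real.pi), (‖f t‖₊ : ℝ≥0∞) ^ 2

/-- Membership in `Q_p(𝕋)` for a function on the unit circle (parametrized by angle):
`f ∈ L²(𝕋)` and `sup_{I ⊂ 𝕋} |I|^{-p} ∫_I ∫_I |f(ξ) - f(η)|²/|ξ - η|^{2-p} |dξ||dη| < ∞`. -/
def MemQpT (p : ℝ) (f : ℝ → ℂ) : Prop :=
  Function.Periodic f (2 * Real.pi) ∧ Measurable f ∧ l2Circle f < ⊤ ∧
    ∃ C : ℝ, ∀ θ : ℝ, ∀ h ∈ Set.Ioc (0 : ℝ) 1, qpTDouble p f θ h ≤ ENNReal.ofReal (C * h ^ p)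

/-- The square of the `Q_p` norm of an analytic function `f` on the disk with boundary
values `fb`. -/
def qpNormSq (p : ℝ) (f : ℂ → ℂ) (fb : ℝ → ℂ) : ℝ≥0∞ :=
  l2Circle fb + ⨆ a ∈ unitDisk, qpIntegral p f a

/-- The square of the `Q_p(𝕋)` norm of a function on the unit circle. -/
def qpTNormSq (p : ℝ) (fb : ℝ → ℂ) : ℝ≥0∞ :=
  l2Circle fb + ⨆ (θ : ℝ) (h : ℝ) (_ : h ∈ Set.Ioc (0 : ℝ) 1),
    qpTDouble p fb θ h / ENNReal.ofReal (h ^ p)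

/-- `fb` is the a.e. radial boundary-value function of `F`. -/
def RadialLimit (F : ℂ → ℂ) (fb : ℝ → ℂ) : Prop :=
  ∀ᵐ t : ℝ, Filter.Tendsto (fun r : ℝ => F ((r : ℂ) * Complex.exp (Complex.I * t)))
    (nhdsWithin 1 (Set.Iio 1)) (nhds (fb t))

/-- The Poisson integral (harmonic extension) of a function on the unit circle. -/
def poissonExt (f : ℝ → ℂ) (z : ℂ) : ℂ :=
  (1 / (2 * Real.pi)) • ∫ t in (0 : ℝ)..(2 * Real.pi),
    ((1 - ‖z‖ ^ 2) / ‖Complex.exp (Complex.I * t) - z‖ ^ 2) • f t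

lemma aux_den_pos {a z : ℂ} (_ha : ‖a‖ < 1) (hz : ‖z‖ < 1) :
    1 - ‖a‖ ≤ ‖1 - (starRingEnd ℂ) a * z‖ := by
  have h1 : ‖(starRingEnd ℂ) a * z‖ ≤ ‖a‖ := by
    rw [norm_mul, RCLike.norm_conj]
    nlinarith [norm_nonneg a, norm_nonneg z]
  have h2 := norm_sub_norm_le (1 : ℂ) ((starRingEnd ℂ) a * z)
  rw [norm_one] at h2
  linarith

lemma aux_den_z {a z : ℂ} (ha : ‖a‖ < 1) (_hz : ‖z‖ < 1) :
    1 - ‖z‖ ≤ ‖1 - (starRingEnd ℂ) a * z‖ := by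
  have h1 : ‖(starRingEnd ℂ) a * z‖ ≤ ‖z‖ := by
    rw [norm_mul, RCLike.norm_conj]
    nlinarith [norm_nonneg a, norm_nonneg z]
  have h2 := norm_sub_norm_le (1 : ℂ) ((starRingEnd ℂ) a * z)
  rw [norm_one] at h2
  linarith

lemma moebius_identity {a z : ℂ} (ha : ‖a‖ < 1) (hz : ‖z‖ < 1) :
    1 - ‖moebius a z‖ ^ 2 =
      (1 - ‖z‖ ^ 2) * ((1 - ‖a‖ ^ 2) / ‖1 - (starRingEnd ℂ) a * z‖ ^ 2) := by
  have h0 : 0 < ‖1 - (starRingEnd ℂ) a * z‖ := by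
    have := aux_den_pos ha hz
    linarith
  unfold moebius
  rw [norm_div, div_pow]
  rw [← mul_div_assoc, eq_div_iff (by positivity), sub_mul, div_mul_cancel₀ _ (by positivity),
    one_mul]
  rw [Complex.sq_norm, Complex.sq_norm, Complex.sq_norm, Complex.sq_norm]
  simp only [Complex.normSq_apply, Complex.sub_re, Complex.sub_im, Complex.mul_re, Complex.mul_im,
    Complex.conj_re, Complex.conj_im, Complex.one_re, Complex.one_im]
  ring

/-- Points of the disk outside the Carleson box are far from the centre. -/
lemma sublevel_subset_box {a z : ℂ} (ha : ‖a‖ < 1) (hz : ‖z‖ < 1) {h : ℝ} (hh : h ≤ 1)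
    (hlt : ‖1 - (starRingEnd ℂ) a * z‖ < h) : z ∈ carlesonBox (Complex.arg a) h := by
  have h1 := aux_den_z ha hz
  refine ⟨by linarith, hz, ?_⟩
  set u := Complex.arg (z * Complex.exp (-(Complex.I * (Complex.arg a : ℂ)))) with hu
  have hn : ‖z * Complex.exp (-(Complex.I * (Complex.arg a : ℂ)))‖ = ‖z‖ := by
    rw [norm_mul]
    have : ‖Complex.exp (-(Complex.I * (Complex.arg a : ℂ)))‖ = 1 := by
      rw [show -(Complex.I * (Complex.arg a : ℂ)) = ((-(Complex.arg a) : ℝ) : ℂ) * Complex.I by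
        push_cast; ring]
      exact Complex.norm_exp_ofReal_mul_I _
    rw [this, mul_one]
  have hz1 : (‖z‖ : ℂ) * Complex.exp (u * Complex.I)
      = z * Complex.exp (-(Complex.I * (Complex.arg a : ℂ))) := by
    have := Complex.norm_mul_exp_arg_mul_I (z * Complex.exp (-(Complex.I * (Complex.arg a : ℂ))))
    rwa [hn] at this
  have hz2 : z = (‖z‖ : ℂ) * Complex.exp (Complex.I * ((u + Complex.arg a : ℝ) : ℂ)) := by
    have : Complex.exp (Complex.I * ((u + Complex.arg a : ℝ) : ℂ))
        = Complex.exp (u * Complex.I) * Complex.exp (Complex.I * (Complex.arg a : ℂ)) := by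
      rw [← Complex.exp_add]; congr 1; push_cast; ring
    rw [this, ← mul_assoc, hz1, mul_assoc, ← Complex.exp_add]
    simp
  refine ⟨u + Complex.arg a, ?_, hz2⟩
  rw [add_sub_cancel_right]
  have ha2 : (starRingEnd ℂ) a = (‖a‖ : ℂ) * Complex.exp (-(Complex.I * (Complex.arg a : ℂ))) := by
    conv_lhs => rw [← Complex.norm_mul_exp_arg_mul_I a]
    rw [map_mul, Complex.conj_ofReal, ← Complex.exp_conj]
    congr 2
    simp [Complex.conj_ofReal]; ring
  have hprod : (starRingEnd ℂ) a * z = ((‖a‖ * ‖z‖ : ℝ) : ℂ) * Complex.exp (Complex.I * u) := by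
    rw [ha2, mul_assoc, mul_comm (Complex.exp _) z, ← hz1]
    push_cast
    rw [mul_comm Complex.I (u : ℂ)]; ring
  set s := ‖a‖ * ‖z‖ with hs
  have hs0 : 0 ≤ s := by positivity
  have hs1 : s ≤ 1 := by nlinarith [norm_nonneg a, norm_nonneg z]
  have hE : ‖Complex.exp (Complex.I * u)‖ = 1 := by
    rw [mul_comm]; exact Complex.norm_exp_ofReal_mul_I _
  rw [hprod] at hlt
  have hA : 1 - s ≤ ‖1 - (s : ℂ) * Complex.exp (Complex.I * u)‖ := by
    have := norm_sub_norm_le (1 : ℂ) ((s : ℂ) * Complex.exp (Complex.I * u))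
    rw [norm_mul, hE, norm_one, Complex.norm_real, Real.norm_of_nonneg hs0] at this
    linarith
  have hB : ‖Complex.exp (Complex.I * u) - 1‖
      ≤ ‖1 - (s : ℂ) * Complex.exp (Complex.I * u)‖ + (1 - s) := by
    have e : Complex.exp (Complex.I * u) - 1
      = -(1 - (s : ℂ) * Complex.exp (Complex.I * u))
        + ((1 - s : ℝ) : ℂ) * Complex.exp (Complex.I * u) := by
      push_cast; ring
    rw [e]
    refine (norm_add_le _ _).trans ?_
    rw [norm_neg, norm_mul, hE, Complex.norm_real, Real.norm_of_nonneg (by linarith), mul_one]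
  rw [Complex.norm_exp_I_mul_ofReal_sub_one, norm_mul, Real.norm_eq_abs, Real.norm_eq_abs,
    abs_two] at hB
  have hu2 : |u / 2| ≤ π / 2 := by
    rw [abs_div, abs_two]
    have := Complex.abs_arg_le_pi (z * Complex.exp (-(Complex.I * (Complex.arg a : ℂ))))
    rw [← hu] at this
    linarith
  have hC := Real.mul_abs_le_abs_sin hu2
  rw [abs_div, abs_two] at hC
  have hD : |u| / π < h := by
    have : 2 / π * (|u| / 2) = |u| / π := by ring
    linarith
  rw [div_lt_iff₀ Real.pi_pos] at hD
  linarith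

/-- The Carleson box is contained in a sublevel set of `|1 - ā z|`. -/
lemma box_subset_sublevel {θ h : ℝ} (h0 : 0 < h) (h1 : h ≤ 1) {z : ℂ} (hz : z ∈ carlesonBox θ h) :
    ‖1 - (starRingEnd ℂ) (((1 - h : ℝ) : ℂ) * Complex.exp (Complex.I * θ)) * z‖ ≤ 6 * h := by
  obtain ⟨hz1, hz2, t, ht, hzt⟩ := hz
  set r := ‖z‖ with hr
  have e : (starRingEnd ℂ) (((1 - h : ℝ) : ℂ) * Complex.exp (Complex.I * θ)) * z
      = (((1 - h) * r : ℝ) : ℂ) * Complex.exp (Complex.I * ((t - θ : ℝ) : ℂ)) := by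
    have : Complex.exp (Complex.I * ((t - θ : ℝ) : ℂ))
        = Complex.exp (-(Complex.I * θ)) * Complex.exp (Complex.I * t) := by
      rw [← Complex.exp_add]; congr 1; push_cast; ring
    rw [this, hzt, map_mul, Complex.conj_ofReal, ← Complex.exp_conj]
    simp only [map_mul, Complex.conj_I, Complex.conj_ofReal]
    push_cast
    rw [neg_mul]
    ring
  rw [e]
  set q := (1 - h) * r with hq
  have hr0 : 0 ≤ r := norm_nonneg z
  have hq0 : 0 ≤ q := mul_nonneg (by linarith) hr0
  have hq1 : q ≤ 1 := by nlinarith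
  have e2 : 1 - (q : ℂ) * Complex.exp (Complex.I * ((t - θ : ℝ) : ℂ))
      = ((1 - q : ℝ) : ℂ) - (q : ℂ) * (Complex.exp (Complex.I * ((t - θ : ℝ) : ℂ)) - 1) := by
    push_cast; ring
  rw [e2]
  refine (norm_sub_le _ _).trans ?_
  rw [norm_mul, Complex.norm_real, Complex.norm_real, Real.norm_of_nonneg (by linarith),
    Real.norm_of_nonneg hq0]
  have h3 : ‖Complex.exp (Complex.I * ((t - θ : ℝ) : ℂ)) - 1‖ ≤ 4 * h := by
    refine (Real.norm_exp_I_mul_ofReal_sub_one_le).trans ?_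
    rw [Real.norm_eq_abs]
    nlinarith [Real.pi_le_four]
  have h4 : 1 - q ≤ 2 * h := by nlinarith
  have h5 : q * ‖Complex.exp (Complex.I * ((t - θ : ℝ) : ℂ)) - 1‖ ≤ 1 * (4 * h) :=
    mul_le_mul hq1 h3 (norm_nonneg _) (by norm_num)
  linarith

/-- The kernel `((1 - |a|²)/|1 - ā z|²)^p`. -/
def qpKer (p : ℝ) (a z : ℂ) : ℝ≥0∞ :=
  ENNReal.ofReal (((1 - ‖a‖ ^ 2) / ‖1 - (starRingEnd ℂ) a * z‖ ^ 2) ^ p)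

lemma measurable_qpKer (p : ℝ) (a : ℂ) : Measurable (qpKer p a) := by
  unfold qpKer
  fun_prop

lemma measurable_weight (p : ℝ) (f : ℂ → ℂ) :
    Measurable fun z => ENNReal.ofReal (‖deriv f z‖ ^ 2 * (1 - ‖z‖ ^ 2) ^ p) := by
  have := measurable_deriv f
  fun_prop

lemma qpIntegral_eq (p : ℝ) (f : ℂ → ℂ) {a : ℂ} (ha : ‖a‖ < 1) :
    qpIntegral p f a =
      ∫⁻ z, qpKer p a z ∂(diskMeasure fun z => ‖deriv f z‖ ^ 2 * (1 - ‖z‖ ^ 2) ^ p) := by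
  unfold diskMeasure
  rw [lintegral_withDensity_eq_lintegral_mul _ (measurable_weight p f) (measurable_qpKer p a)]
  unfold qpIntegral
  refine setLIntegral_congr_fun measurableSet_ball ?_
  intro z hz
  have hz : ‖z‖ < 1 := by simpa [unitDisk] using hz
  have h1 : 0 ≤ 1 - ‖z‖ ^ 2 := by nlinarith [norm_nonneg z]
  have h2 : 0 ≤ 1 - ‖a‖ ^ 2 := by nlinarith [norm_nonneg a]
  simp only [Pi.mul_apply, qpKer]
  rw [moebius_identity ha hz, Real.mul_rpow h1 (by positivity), ← mul_assoc,
    ENNReal.ofReal_mul (by positivity)]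

lemma carleson_of_qp (p : ℝ) (hp0 : 0 < p) (f : ℂ → ℂ) (C : ℝ)
    (hC : ∀ a ∈ unitDisk, qpIntegral p f a ≤ ENNReal.ofReal C) :
    IsPCarleson p (diskMeasure fun z => ‖deriv f z‖ ^ 2 * (1 - ‖z‖ ^ 2) ^ p) := by
  refine ⟨C * 36 ^ p, fun θ h hh => ?_⟩
  obtain ⟨h0, h1⟩ := hh
  set a : ℂ := ((1 - h : ℝ) : ℂ) * Complex.exp (Complex.I * θ) with ha
  have hna : ‖a‖ = 1 - h := by
    rw [ha, norm_mul, mul_comm Complex.I, Complex.norm_exp_ofReal_mul_I, mul_one,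
      Complex.norm_real, Real.norm_of_nonneg (by linarith)]
  have ha1 : ‖a‖ < 1 := by rw [hna]; linarith
  have hCa := hC a (by simpa [unitDisk] using ha1)
  rw [qpIntegral_eq p f ha1] at hCa
  set μ := diskMeasure fun z => ‖deriv f z‖ ^ 2 * (1 - ‖z‖ ^ 2) ^ p
  have hpos : 0 < (1 / (36 * h)) ^ p := by positivity
  have hsub : carlesonBox θ h ⊆ {z | ENNReal.ofReal ((1 / (36 * h)) ^ p) ≤ qpKer p a z} := by
    intro z hz
    have hb := box_subset_sublevel h0 h1 hz
    rw [← ha] at hb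
    have hd := aux_den_pos ha1 hz.2.1
    have hd0 : 0 < ‖1 - (starRingEnd ℂ) a * z‖ := by linarith
    refine ENNReal.ofReal_le_ofReal (Real.rpow_le_rpow (by positivity) ?_ hp0.le)
    rw [div_le_div_iff₀ (by positivity) (by positivity), hna]
    have : ‖1 - (starRingEnd ℂ) a * z‖ ^ 2 ≤ (6 * h) ^ 2 := by gcongr
    nlinarith
  calc μ (carlesonBox θ h) ≤ _ := measure_mono hsub
    _ ≤ (∫⁻ z, qpKer p a z ∂μ) / ENNReal.ofReal ((1 / (36 * h)) ^ p) :=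
        meas_ge_le_lintegral_div (measurable_qpKer p a).aemeasurable
          (by simpa using hpos) ENNReal.ofReal_ne_top
    _ ≤ ENNReal.ofReal C / ENNReal.ofReal ((1 / (36 * h)) ^ p) := by gcongr
    _ = ENNReal.ofReal (C * 36 ^ p * h ^ p) := by
        rw [← ENNReal.ofReal_div_of_pos hpos, Real.div_rpow (by norm_num) (by positivity),
          Real.mul_rpow (by norm_num) h0.le, Real.one_rpow]
        congr 1
        field_simp

lemma ae_mem_disk (w : ℂ → ℝ) : ∀ᵐ z ∂(diskMeasure w), ‖z‖ < 1 ∧ z ≠ 0 := by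
  have h1 : ∀ᵐ z ∂(volume.restrict unitDisk), ‖z‖ < 1 ∧ z ≠ 0 := by
    have hm : ∀ᵐ z ∂(volume.restrict unitDisk), z ∈ unitDisk :=
      ae_restrict_mem measurableSet_ball
    have h0 : ∀ᵐ z ∂(volume.restrict unitDisk), z ≠ (0 : ℂ) :=
      ae_restrict_of_ae (Measure.ae_ne volume 0)
    filter_upwards [hm, h0] with z hz hz0
    exact ⟨by simpa [unitDisk] using hz, hz0⟩
  exact (withDensity_absolutelyContinuous _ _).ae_le h1

lemma carleson_univ {p C : ℝ} {w : ℂ → ℝ}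
    (hC : ∀ θ : ℝ, ∀ h ∈ Set.Ioc (0 : ℝ) 1,
      diskMeasure w (carlesonBox θ h) ≤ ENNReal.ofReal (C * h ^ p)) :
    diskMeasure w univ ≤ ENNReal.ofReal (2 * max C 0) := by
  have h1 : ∀ θ, diskMeasure w (carlesonBox θ 1) ≤ ENNReal.ofReal (max C 0) := by
    intro θ
    refine (hC θ 1 (by simp)).trans (ENNReal.ofReal_le_ofReal ?_)
    simp
  have h2 : diskMeasure w univ ≤ diskMeasure w (carlesonBox 0 1 ∪ carlesonBox π 1) := by
    refine measure_mono_ae ?_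
    filter_upwards [ae_mem_disk w] with z hz _
    have hz0 : 0 < ‖z‖ := norm_pos_iff.2 hz.2
    have he : z = (‖z‖ : ℂ) * Complex.exp (Complex.I * (Complex.arg z : ℝ)) := by
      rw [mul_comm Complex.I]; exact (Complex.norm_mul_exp_arg_mul_I z).symm
    by_cases hp : Complex.arg z = π
    · refine Or.inr ⟨by simpa using hz0, hz.1, Complex.arg z, ?_, he⟩
      rw [hp]; simp [Real.pi_pos]
    · refine Or.inl ⟨by simpa using hz0, hz.1, Complex.arg z, ?_, he⟩
      rw [sub_zero, mul_one, abs_lt]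
      exact ⟨Complex.neg_pi_lt_arg z, lt_of_le_of_ne (Complex.arg_le_pi z) hp⟩
  refine h2.trans ((measure_union_le _ _).trans ((add_le_add (h1 0) (h1 π)).trans ?_))
  rw [← ENNReal.ofReal_add (le_max_right _ _) (le_max_right _ _), two_mul]

lemma carleson_sublevel {p C : ℝ} (hp0 : 0 < p) {w : ℂ → ℝ}
    (hC : ∀ θ : ℝ, ∀ h ∈ Set.Ioc (0 : ℝ) 1,
      diskMeasure w (carlesonBox θ h) ≤ ENNReal.ofReal (C * h ^ p))
    {a : ℂ} (ha : ‖a‖ < 1) {h : ℝ} (h0 : 0 < h) :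
    diskMeasure w {z | ‖1 - (starRingEnd ℂ) a * z‖ < h}
      ≤ ENNReal.ofReal (2 * max C 0 * h ^ p) := by
  have hm : 0 ≤ max C 0 := le_max_right _ _
  by_cases h1 : h ≤ 1
  · have : diskMeasure w {z | ‖1 - (starRingEnd ℂ) a * z‖ < h}
        ≤ diskMeasure w (carlesonBox (Complex.arg a) h) := by
      refine measure_mono_ae ?_
      filter_upwards [ae_mem_disk w] with z hz hlt
      exact sublevel_subset_box ha hz.1 h1 hlt
    refine this.trans ((hC _ h ⟨h0, h1⟩).trans (ENNReal.ofReal_le_ofReal ?_))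
    gcongr
    have := le_max_left C 0
    linarith
  · refine (measure_mono (subset_univ _)).trans ((carleson_univ hC).trans ?_)
    refine ENNReal.ofReal_le_ofReal ?_
    have : 1 ≤ h ^ p := Real.one_le_rpow (by linarith) hp0.le
    nlinarith

lemma qp_of_carleson {p C : ℝ} (hp0 : 0 < p) (f : ℂ → ℂ)
    (hC : ∀ θ : ℝ, ∀ h ∈ Set.Ioc (0 : ℝ) 1,
      diskMeasure (fun z => ‖deriv f z‖ ^ 2 * (1 - ‖z‖ ^ 2) ^ p) (carlesonBox θ h)
        ≤ ENNReal.ofReal (C * h ^ p)) (a : ℂ) (ha : a ∈ unitDisk) :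
    qpIntegral p f a ≤
      ENNReal.ofReal (2 * max C 0 * 4 ^ p * (1 - (1 / 2 : ℝ) ^ p)⁻¹) := by
  have ha : ‖a‖ < 1 := by simpa [unitDisk] using ha
  rw [qpIntegral_eq p f ha]
  set w : ℂ → ℝ := fun z => ‖deriv f z‖ ^ 2 * (1 - ‖z‖ ^ 2) ^ p
  set M := 2 * max C 0 with hM
  have hM0 : 0 ≤ M := by have := le_max_right C 0; positivity
  set d := 1 - ‖a‖ with hd
  have hd0 : 0 < d := by linarith
  set E : ℕ → Set ℂ := fun n => {z | ‖1 - (starRingEnd ℂ) a * z‖ < 2 ^ (n + 1) * d} with hE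
  have hEm : ∀ n, MeasurableSet (E n) := by
    intro n
    refine measurableSet_lt ?_ measurable_const
    fun_prop
  set c : ℕ → ℝ := fun n => (2 / (4 ^ n * d)) ^ p with hc
  have hpt : ∀ᵐ z ∂(diskMeasure w), qpKer p a z
      ≤ ∑' n, (E n).indicator (fun _ => ENNReal.ofReal (c n)) z := by
    filter_upwards [ae_mem_disk w] with z hz
    have hden := aux_den_pos ha hz.1
    obtain ⟨n, hn1, hn2⟩ := exists_nat_pow_near
      (show 1 ≤ ‖1 - (starRingEnd ℂ) a * z‖ / d by rwa [le_div_iff₀ hd0, one_mul])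
      (show (1 : ℝ) < 2 by norm_num)
    rw [le_div_iff₀ hd0] at hn1
    rw [div_lt_iff₀ hd0] at hn2
    refine le_trans ?_ (ENNReal.le_tsum n)
    rw [indicator_of_mem (show z ∈ E n from hn2)]
    have hd0' : 0 < ‖1 - (starRingEnd ℂ) a * z‖ := by linarith
    have h2 : 0 ≤ 1 - ‖a‖ ^ 2 := by nlinarith [norm_nonneg a]
    refine ENNReal.ofReal_le_ofReal (Real.rpow_le_rpow (by positivity) ?_ hp0.le)
    rw [div_le_div_iff₀ (by positivity) (by positivity)]
    have h3 : (2 ^ n * d) ^ 2 ≤ ‖1 - (starRingEnd ℂ) a * z‖ ^ 2 := by gcongr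
    have h4 : (2 ^ n * d) ^ 2 = 4 ^ n * d ^ 2 := by
      rw [mul_pow, ← pow_mul, mul_comm n 2, pow_mul]; norm_num
    have h5 : 1 - ‖a‖ ^ 2 ≤ 2 * d := by nlinarith [norm_nonneg a]
    calc (1 - ‖a‖ ^ 2) * (4 ^ n * d) ≤ 2 * d * (4 ^ n * d) := by gcongr
      _ = 2 * (4 ^ n * d ^ 2) := by ring
      _ ≤ _ := by rw [← h4]; gcongr
  have hq1 : (1 / 2 : ℝ) ^ p < 1 := Real.rpow_lt_one (by norm_num) (by norm_num) hp0
  have hq0 : 0 ≤ (1 / 2 : ℝ) ^ p := by positivity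
  calc ∫⁻ z, qpKer p a z ∂(diskMeasure w)
      ≤ ∫⁻ z, ∑' n, (E n).indicator (fun _ => ENNReal.ofReal (c n)) z ∂(diskMeasure w) :=
        lintegral_mono_ae hpt
    _ = ∑' n, ∫⁻ z, (E n).indicator (fun _ => ENNReal.ofReal (c n)) z ∂(diskMeasure w) :=
        lintegral_tsum fun n => (measurable_const.indicator (hEm n)).aemeasurable
    _ = ∑' n, ENNReal.ofReal (c n) * diskMeasure w (E n) := by
        congr 1; ext n; rw [lintegral_indicator_const (hEm n)]
    _ ≤ ∑' n : ℕ, ENNReal.ofReal (M * 4 ^ p * ((1 / 2 : ℝ) ^ p) ^ n) := by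
        refine ENNReal.tsum_le_tsum fun n => ?_
        have := carleson_sublevel hp0 hC ha (h := 2 ^ (n + 1) * d) (by positivity)
        refine (mul_le_mul_right this _).trans ?_
        rw [← ENNReal.ofReal_mul (by positivity)]
        refine ENNReal.ofReal_le_ofReal (le_of_eq ?_)
        have e1 : ((1 / 2 : ℝ) ^ p) ^ n = ((1 / 2 : ℝ) ^ n) ^ p := by
          rw [← Real.rpow_natCast, ← Real.rpow_mul (by norm_num), mul_comm,
            Real.rpow_mul (by norm_num), Real.rpow_natCast]
        rw [e1, mul_assoc M, ← Real.mul_rpow (by norm_num) (by positivity), hc, ← hM]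
        simp only
        rw [mul_left_comm, ← Real.mul_rpow (by positivity) (by positivity)]
        congr 2
        have : (4 : ℝ) ^ n = 2 ^ n * 2 ^ n := by rw [← mul_pow]; norm_num
        rw [this, pow_succ, div_pow, one_pow]
        field_simp
        norm_num
    _ = ENNReal.ofReal (∑' n : ℕ, M * 4 ^ p * ((1 / 2 : ℝ) ^ p) ^ n) :=
        (ENNReal.ofReal_tsum_of_nonneg (fun n => by positivity)
          ((summable_geometric_of_lt_one hq0 hq1).mul_left _)).symm
    _ = _ := by rw [tsum_mul_left, tsum_geometric_of_lt_one hq0 hq1]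

lemma norm_expI (t : ℝ) : ‖Complex.exp (Complex.I * t)‖ = 1 := by
  rw [mul_comm]; exact Complex.norm_exp_ofReal_mul_I _

lemma series_integral (c : ℕ → ℂ) (hc : Summable fun n => ‖c n‖) (k : ℝ → ℂ) (hk : Continuous k)
    (B : ℝ) (hB : ∀ t, ‖k t‖ ≤ B) (x y : ℝ) :
    HasSum (fun n => ∫ t in x..y, c n * Complex.exp (Complex.I * t) ^ n * k t)
      (∫ t in x..y, (∑' n, c n * Complex.exp (Complex.I * t) ^ n) * k t) := by
  refine intervalIntegral.hasSum_integral_of_dominated_convergence (fun n _ => ‖c n‖ * B)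
    (fun n => ?_) (fun n => ?_) ?_ ?_ ?_
  · exact Continuous.aestronglyMeasurable (by fun_prop)
  · refine Eventually.of_forall fun t _ => ?_
    rw [norm_mul, norm_mul, norm_pow, norm_expI, one_pow, mul_one]
    exact mul_le_mul_of_nonneg_left (hB t) (norm_nonneg _)
  · exact Eventually.of_forall fun t _ => hc.mul_right B
  · exact intervalIntegrable_const
  · refine Eventually.of_forall fun t _ => ?_
    refine HasSum.mul_right _ (Summable.hasSum ?_)
    refine Summable.of_norm ?_
    simpa [norm_mul, norm_pow, norm_expI] using hc

lemma integral_exp_orth (m n : ℕ) (x : ℝ) :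
    ∫ t in x..(x + 2 * π), Complex.exp (Complex.I * t) ^ m *
      (starRingEnd ℂ) (Complex.exp (Complex.I * t) ^ n) = if m = n then 2 * (π : ℂ) else 0 := by
  have e : ∀ t : ℝ, Complex.exp (Complex.I * t) ^ m *
      (starRingEnd ℂ) (Complex.exp (Complex.I * t) ^ n)
        = Complex.exp ((((m : ℂ) - n) * Complex.I) * t) := by
    intro t
    rw [map_pow, ← Complex.exp_conj, ← Complex.exp_nat_mul, ← Complex.exp_nat_mul,
      ← Complex.exp_add]
    congr 1
    simp only [map_mul, Complex.conj_I, Complex.conj_ofReal]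
    ring
  simp_rw [e]
  split_ifs with h
  · subst h; simp
  · have h' : (m : ℂ) - n ≠ 0 := sub_ne_zero.2 (by exact_mod_cast h)
    rw [integral_exp_mul_complex (mul_ne_zero h' Complex.I_ne_zero)]
    have : Complex.exp ((((m : ℂ) - n) * Complex.I) * ((x + 2 * π : ℝ) : ℂ))
        = Complex.exp ((((m : ℂ) - n) * Complex.I) * (x : ℂ)) := by
      rw [Complex.exp_eq_exp_iff_exists_int]
      refine ⟨(m : ℤ) - n, ?_⟩
      push_cast; ring
    rw [this]; simp

lemma parseval (c : ℕ → ℂ) (hc : Summable fun n => ‖c n‖) (x : ℝ) :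
    HasSum (fun n => 2 * π * ‖c n‖ ^ 2)
      (∫ t in x..(x + 2 * π), ‖∑' n, c n * Complex.exp (Complex.I * t) ^ n‖ ^ 2) := by
  set g : ℝ → ℂ := fun t => ∑' n, c n * Complex.exp (Complex.I * t) ^ n with hg
  have hn : ∀ n (t : ℝ), ‖c n * Complex.exp (Complex.I * t) ^ n‖ = ‖c n‖ := by
    intro n t; rw [norm_mul, norm_pow, norm_expI, one_pow, mul_one]
  have hgc : Continuous g := by
    refine continuous_tsum (fun n => by fun_prop) hc (fun n t => (hn n t).le)
  have hgB : ∀ t, ‖g t‖ ≤ ∑' n, ‖c n‖ := by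
    intro t
    have h1 : Summable fun n => ‖c n * Complex.exp (Complex.I * t) ^ n‖ := by simpa only [hn]
    have := norm_tsum_le_tsum_norm h1
    simpa only [hn] using this
  have h1 : ∀ n : ℕ, ∫ t in x..(x + 2 * π), g t *
      (starRingEnd ℂ) (Complex.exp (Complex.I * t) ^ n) = 2 * π * c n := by
    intro n
    have := series_integral c hc (fun t => (starRingEnd ℂ) (Complex.exp (Complex.I * t) ^ n))
      (by fun_prop) 1 (fun t => by simp) x (x + 2 * π)
    refine this.unique ?_
    have e : ∀ m : ℕ, ∫ t in x..(x + 2 * π), c m * Complex.exp (Complex.I * t) ^ m *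
        (starRingEnd ℂ) (Complex.exp (Complex.I * t) ^ n)
          = if m = n then 2 * (π : ℂ) * c n else 0 := by
      intro m
      simp_rw [mul_assoc (c m)]
      rw [intervalIntegral.integral_const_mul, integral_exp_orth]
      split_ifs with h
      · subst h; ring
      · simp
    simp_rw [e]
    exact hasSum_ite_eq n _
  have h2 : ∀ n : ℕ, ∫ t in x..(x + 2 * π), c n * Complex.exp (Complex.I * t) ^ n *
      (starRingEnd ℂ) (g t) = ((2 * π * ‖c n‖ ^ 2 : ℝ) : ℂ) := by
    intro n
    have h3 : ∫ t in x..(x + 2 * π), Complex.exp (Complex.I * t) ^ n * (starRingEnd ℂ) (g t)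
        = (starRingEnd ℂ) (2 * π * c n) := by
      rw [← h1 n]
      rw [intervalIntegral.integral_of_le (by linarith [Real.pi_pos]),
        intervalIntegral.integral_of_le (by linarith [Real.pi_pos]), ← integral_conj]
      congr 1; ext t
      simp [mul_comm]
    simp_rw [mul_assoc (c n)]
    rw [intervalIntegral.integral_const_mul, h3]
    simp only [map_mul, Complex.conj_ofReal, map_ofNat]
    push_cast
    rw [← Complex.mul_conj']
    ring
  have h4 := series_integral c hc (fun t => (starRingEnd ℂ) (g t)) (by fun_prop)
    (∑' n, ‖c n‖) (fun t => by simpa using hgB t) x (x + 2 * π)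
  simp_rw [h2] at h4
  have h5 : ∫ t in x..(x + 2 * π), g t * (starRingEnd ℂ) (g t)
      = ((∫ t in x..(x + 2 * π), ‖g t‖ ^ 2 : ℝ) : ℂ) := by
    rw [← intervalIntegral.integral_ofReal]
    congr 1; ext t
    rw [Complex.mul_conj']; push_cast; rfl
  rw [h5] at h4
  exact_mod_cast h4

/-- Taylor coefficients at the origin. -/
def tcoef (f : ℂ → ℂ) (n : ℕ) : ℂ := (n.factorial : ℂ)⁻¹ * iteratedDeriv n f 0

lemma tcoef_deriv (f : ℂ → ℂ) (n : ℕ) : tcoef (deriv f) n = (n + 1) * tcoef f (n + 1) := by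
  unfold tcoef
  rw [iteratedDeriv_succ', Nat.factorial_succ]
  have h1 : (n.factorial : ℂ) ≠ 0 := by exact_mod_cast n.factorial_ne_zero
  have h2 : (n : ℂ) + 1 ≠ 0 := by exact_mod_cast n.succ_ne_zero
  push_cast
  field_simp

lemma tcoef_hasSum {f : ℂ → ℂ} (hf : DifferentiableOn ℂ f unitDisk) {z : ℂ} (hz : ‖z‖ < 1) :
    HasSum (fun n => tcoef f n * z ^ n) (f z) := by
  have := Complex.hasSum_taylorSeries_on_ball hf (z := z) (by simpa using hz)
  have e : (fun n => tcoef f n * z ^ n)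
      = fun n : ℕ => (n.factorial : ℂ)⁻¹ • (z - 0) ^ n • iteratedDeriv n f 0 := by
    funext n
    simp only [tcoef, sub_zero, smul_eq_mul]
    ring
  rw [e]
  exact this

lemma circle_parseval {f : ℂ → ℂ} (hf : DifferentiableOn ℂ f unitDisk) {r : ℝ} (hr0 : 0 ≤ r)
    (hr1 : r < 1) (x : ℝ) :
    HasSum (fun n => 2 * π * (‖tcoef f n‖ ^ 2 * r ^ (2 * n)))
      (∫ t in x..(x + 2 * π), ‖f ((r : ℂ) * Complex.exp (Complex.I * t))‖ ^ 2) := by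
  have hr : ‖(r : ℂ)‖ < 1 := by rwa [Complex.norm_real, Real.norm_of_nonneg hr0]
  have hs := (tcoef_hasSum hf hr).summable.norm
  have : HasSum (fun n => 2 * π * ‖tcoef f n * (r : ℂ) ^ n‖ ^ 2)
      (∫ t in x..(x + 2 * π),
        ‖∑' n, tcoef f n * (r : ℂ) ^ n * Complex.exp (Complex.I * t) ^ n‖ ^ 2) :=
    parseval (fun n => tcoef f n * (r : ℂ) ^ n) hs x
  have e : ∀ t : ℝ, ∑' n, tcoef f n * (r : ℂ) ^ n * Complex.exp (Complex.I * t) ^ n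
      = f ((r : ℂ) * Complex.exp (Complex.I * t)) := by
    intro t
    rw [← (tcoef_hasSum hf (z := (r : ℂ) * Complex.exp (Complex.I * t))
      (by rw [norm_mul, norm_expI, mul_one]; exact hr)).tsum_eq]
    congr 1; ext n; rw [mul_pow, mul_assoc]
  simp only [e] at this
  convert this using 2 with n
  rw [norm_mul, norm_pow, Complex.norm_real, Real.norm_of_nonneg hr0, mul_pow, ← pow_mul,
    mul_comm n 2]

lemma radial_integral (n : ℕ) :
    ∫⁻ r in Set.Ioo (0 : ℝ) 1, ENNReal.ofReal (r * (1 - r ^ 2) * r ^ (2 * n))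
      = ENNReal.ofReal (1 / (2 * (n + 1) * (n + 2))) := by
  have hi : IntervalIntegrable (fun r : ℝ => r * (1 - r ^ 2) * r ^ (2 * n)) volume 0 1 :=
    Continuous.intervalIntegrable (by fun_prop) _ _
  have hi' : IntegrableOn (fun r : ℝ => r * (1 - r ^ 2) * r ^ (2 * n)) (Set.Ioo 0 1) := by
    rw [intervalIntegrable_iff_integrableOn_Ioo_of_le (by norm_num)] at hi
    exact hi
  rw [← ofReal_integral_eq_lintegral_ofReal hi']
  · congr 1
    rw [← integral_Ioc_eq_integral_Ioo, ← intervalIntegral.integral_of_le (by norm_num)]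
    have e : ∀ r : ℝ, r * (1 - r ^ 2) * r ^ (2 * n) = r ^ (2 * n + 1) - r ^ (2 * n + 3) := by
      intro r; ring
    simp_rw [e]
    rw [intervalIntegral.integral_sub (Continuous.intervalIntegrable (by fun_prop) _ _)
      (Continuous.intervalIntegrable (by fun_prop) _ _), integral_pow, integral_pow]
    push_cast
    rw [zero_pow (by omega), zero_pow (by omega)]
    have h1 : (2 * (n : ℝ) + 1 + 1) ≠ 0 := by positivity
    have h2 : (2 * (n : ℝ) + 3 + 1) ≠ 0 := by positivity
    have h3 : ((n : ℝ) + 1) ≠ 0 := by positivity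
    have h4 : ((n : ℝ) + 2) ≠ 0 := by positivity
    field_simp
    ring
  · filter_upwards [ae_restrict_mem measurableSet_Ioo] with r hr
    have h1 := hr.1
    have h2 := hr.2
    have : 0 ≤ 1 - r ^ 2 := by nlinarith
    simp only [Pi.zero_apply]
    positivity

lemma littlewood_paley {f : ℂ → ℂ} (hf : DifferentiableOn ℂ f unitDisk)
    (hfin : ∫⁻ z in unitDisk, ENNReal.ofReal (‖deriv f z‖ ^ 2 * (1 - ‖z‖ ^ 2)) ≠ ⊤) :
    Summable fun n => ‖tcoef f (n + 1)‖ ^ 2 := by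
  have hf' : DifferentiableOn ℂ (deriv f) unitDisk := hf.deriv isOpen_ball
  have hmd := measurable_deriv f
  set G : ℂ → ℝ≥0∞ := fun z => ENNReal.ofReal (‖deriv f z‖ ^ 2 * (1 - ‖z‖ ^ 2)) with hG
  have hGm : Measurable G := by rw [hG]; fun_prop
  have hDm : MeasurableSet unitDisk := measurableSet_ball
  have hpolar : ∫⁻ r in Set.Ioo (0 : ℝ) 1, ∫⁻ t in Set.Ioo (-π) π,
      ENNReal.ofReal r * unitDisk.indicator G ((r : ℂ) * Complex.exp (Complex.I * t))
      ≤ ∫⁻ z in unitDisk, G z := by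
    rw [← lintegral_indicator hDm, ← Complex.lintegral_comp_polarCoord_symm]
    have hmeas : Measurable fun q : ℝ × ℝ =>
        ENNReal.ofReal q.1 • unitDisk.indicator G (Complex.polarCoord.symm q) := by
      have h1 : Measurable (unitDisk.indicator G) := hGm.indicator hDm
      have h2 : Measurable fun q : ℝ × ℝ => Complex.polarCoord.symm q := by
        simp_rw [Complex.polarCoord_symm_apply]
        fun_prop
      exact (by fun_prop : Measurable fun q : ℝ × ℝ => ENNReal.ofReal q.1).mul (h1.comp h2)
    rw [polarCoord_target, Measure.volume_eq_prod, setLIntegral_prod _ hmeas.aemeasurable]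
    refine le_trans (le_of_eq ?_) (lintegral_mono_set (fun r (hr : r ∈ Set.Ioo (0 : ℝ) 1) => hr.1))
    simp only [Complex.polarCoord_symm_apply, smul_eq_mul]
    congr 1; ext r; congr 1; ext t
    rw [mul_comm Complex.I, Complex.exp_mul_I]
    push_cast
    rfl
  have hinner : ∀ r ∈ Set.Ioo (0 : ℝ) 1, ∫⁻ t in Set.Ioo (-π) π,
      ENNReal.ofReal r * unitDisk.indicator G ((r : ℂ) * Complex.exp (Complex.I * t))
      = ∑' n : ℕ, ENNReal.ofReal (2 * π * ‖tcoef (deriv f) n‖ ^ 2) *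
          ENNReal.ofReal (r * (1 - r ^ 2) * r ^ (2 * n)) := by
    intro r hr
    obtain ⟨hr0, hr1⟩ := hr
    have hr2 : 0 ≤ 1 - r ^ 2 := by nlinarith
    have hnorm : ∀ t : ℝ, ‖(r : ℂ) * Complex.exp (Complex.I * t)‖ = r := by
      intro t; rw [norm_mul, norm_expI, mul_one, Complex.norm_real, Real.norm_of_nonneg hr0.le]
    have hmem : ∀ t : ℝ, (r : ℂ) * Complex.exp (Complex.I * t) ∈ unitDisk := by
      intro t; rw [unitDisk, mem_ball_zero_iff, hnorm t]; exact hr1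
    have e : ∀ t : ℝ, ENNReal.ofReal r *
        unitDisk.indicator G ((r : ℂ) * Complex.exp (Complex.I * t))
        = ENNReal.ofReal (r * (1 - r ^ 2)) *
          ENNReal.ofReal (‖deriv f ((r : ℂ) * Complex.exp (Complex.I * t))‖ ^ 2) := by
      intro t
      rw [indicator_of_mem (hmem t), hG]
      simp only [hnorm t]
      rw [← ENNReal.ofReal_mul hr0.le, ← ENNReal.ofReal_mul (by positivity)]
      congr 1; ring
    simp_rw [e]
    rw [lintegral_const_mul _ (by fun_prop)]
    have hcont : Continuous fun t : ℝ =>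
        ‖deriv f ((r : ℂ) * Complex.exp (Complex.I * t))‖ ^ 2 := by
      refine Continuous.pow (Continuous.norm ?_) 2
      refine hf'.continuousOn.comp_continuous (by fun_prop) hmem
    have hint : IntegrableOn (fun t : ℝ =>
        ‖deriv f ((r : ℂ) * Complex.exp (Complex.I * t))‖ ^ 2) (Set.Ioo (-π) π) := by
      have := hcont.intervalIntegrable (μ := volume) (-π) π
      rwa [intervalIntegrable_iff_integrableOn_Ioo_of_le (by linarith [Real.pi_pos])] at this
    rw [← ofReal_integral_eq_lintegral_ofReal hint (Eventually.of_forall fun t => by positivity),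
      ← integral_Ioc_eq_integral_Ioo, ← intervalIntegral.integral_of_le (by linarith [Real.pi_pos])]
    have hp := circle_parseval hf' hr0.le hr1 (-π)
    rw [show -π + 2 * π = π by ring] at hp
    rw [← hp.tsum_eq, ENNReal.ofReal_tsum_of_nonneg (fun n => by positivity) hp.summable,
      ← ENNReal.tsum_mul_left]
    congr 1; ext n
    rw [← ENNReal.ofReal_mul (by positivity), ← ENNReal.ofReal_mul (by positivity)]
    congr 1; ring
  rw [setLIntegral_congr_fun measurableSet_Ioo hinner,
    lintegral_tsum (fun n => Measurable.aemeasurable (by fun_prop))] at hpolar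
  have hle : ∑' n : ℕ, ENNReal.ofReal (‖tcoef f (n + 1)‖ ^ 2) ≤ ∫⁻ z in unitDisk, G z := by
    refine le_trans (ENNReal.tsum_le_tsum fun n => ?_) hpolar
    rw [lintegral_const_mul _ (by fun_prop), radial_integral,
      ← ENNReal.ofReal_mul (by positivity)]
    refine ENNReal.ofReal_le_ofReal ?_
    rw [tcoef_deriv, norm_mul, mul_pow]
    have : ‖(n : ℂ) + 1‖ = n + 1 := by
      have := Complex.norm_natCast (n + 1)
      push_cast at this; exact this
    rw [this]
    set T := ‖tcoef f (n + 1)‖ ^ 2 with hT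
    have hT0 : 0 ≤ T := by positivity
    rw [mul_one_div, le_div_iff₀ (by positivity)]
    have hn : (0 : ℝ) ≤ n := Nat.cast_nonneg n
    have h3 : 2 * ((n : ℝ) + 1) * (n + 2) ≤ 2 * π * (n + 1) ^ 2 := by
      nlinarith [Real.pi_gt_three, mul_nonneg (sub_nonneg.2 Real.pi_gt_three.le)
        (sq_nonneg ((n : ℝ) + 1))]
    calc T * (2 * ((n : ℝ) + 1) * (n + 2)) ≤ T * (2 * π * (n + 1) ^ 2) := by gcongr
      _ = _ := by ring
  have hne : ∑' n : ℕ, ENNReal.ofReal (‖tcoef f (n + 1)‖ ^ 2) ≠ ⊤ := ne_top_of_le_ne_top hfin hle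
  have := ENNReal.summable_toReal hne
  simpa [ENNReal.toReal_ofReal] using this

lemma h2_of_summable {f : ℂ → ℂ} (hf : DifferentiableOn ℂ f unitDisk)
    (hs : Summable fun n => ‖tcoef f (n + 1)‖ ^ 2) : h2Bounded f := by
  have hs' : Summable fun n => ‖tcoef f n‖ ^ 2 :=
    (summable_nat_add_iff (f := fun n => ‖tcoef f n‖ ^ 2) 1).1 hs
  refine ⟨∑' n, 2 * π * ‖tcoef f n‖ ^ 2, fun r hr => ?_⟩
  have h := circle_parseval hf hr.1 hr.2 0
  rw [zero_add] at h
  refine hasSum_le (fun n => ?_) h (hs'.mul_left (2 * π)).hasSum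
  have : r ^ (2 * n) ≤ 1 := pow_le_one₀ hr.1 hr.2.le
  have h2 : ‖tcoef f n‖ ^ 2 * r ^ (2 * n) ≤ ‖tcoef f n‖ ^ 2 * 1 := by gcongr
  rw [mul_one] at h2
  gcongr

/-- For `0 < p ≤ 1`, an analytic function `f` on the unit disk belongs to `Q_p` if and
only if `|f'(z)|² (1 - |z|²)^p dA(z)` is a `p`-Carleson measure. -/
theorem memQp_iff_pCarleson (p : ℝ) (hp0 : 0 < p) (hp1 : p ≤ 1)
    (f : ℂ → ℂ) (hf : DifferentiableOn ℂ f unitDisk) :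
    MemQp p f ↔
      IsPCarleson p (diskMeasure fun z => ‖deriv f z‖ ^ 2 * (1 - ‖z‖ ^ 2) ^ p) := by
  constructor
  · rintro ⟨_, _, C, hC⟩
    exact carleson_of_qp p hp0 f C hC
  · rintro ⟨C, hC⟩
    refine ⟨hf, h2_of_summable hf (littlewood_paley hf ?_), _, qp_of_carleson hp0 f hC⟩
    have h1 := carleson_univ hC
    unfold diskMeasure at h1
    rw [withDensity_apply _ MeasurableSet.univ, Measure.restrict_univ] at h1
    refine ne_top_of_le_ne_top (ne_top_of_le_ne_top ENNReal.ofReal_ne_top h1) ?_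
    refine setLIntegral_mono' measurableSet_ball fun z hz => ENNReal.ofReal_le_ofReal ?_
    have hz : ‖z‖ < 1 := by simpa [unitDisk] using hz
    have h2 : 0 < 1 - ‖z‖ ^ 2 := by nlinarith [norm_nonneg z]
    have h3 : 1 - ‖z‖ ^ 2 ≤ 1 := by nlinarith [norm_nonneg z]
    refine mul_le_mul_of_nonneg_left ?_ (by positivity)
    have := Real.rpow_le_rpow_of_exponent_ge h2 h3 hp1
    rwa [Real.rpow_one] at this

end
end

section
/- Let 0 < p < 1 and let g be a measurable function on the unit disk D. If the measure |g(z)|^2 (1 - |z|^2)^p dA(z) is a p-Carleson measure on D, then the measure |g(z)| dA(z) is a (1-)Carleson measure on D. -/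
open MeasureTheory Complex Metric Set Filter
open scoped ENNReal Real

noncomputable section

/-- The Carleson box centred at angle zero, described by modulus and argument. -/
def argBox (h : ℝ) : Set ℂ :=
  {z : ℂ | 1 - h < ‖z‖ ∧ ‖z‖ < 1 ∧ |Complex.arg z| < Real.pi * h}

theorem measurableSet_argBox (h : ℝ) : MeasurableSet (argBox h) := by
  have h1 : MeasurableSet {z : ℂ | 1 - h < ‖z‖} := measurableSet_lt (by fun_prop) (by fun_prop)
  have h2 : MeasurableSet {z : ℂ | ‖z‖ < 1} := measurableSet_lt (by fun_prop) (by fun_prop)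
  have h3 : MeasurableSet {z : ℂ | |Complex.arg z| < Real.pi * h} :=
    measurableSet_lt (continuous_abs.measurable.comp Complex.measurable_arg) (by fun_prop)
  exact h1.inter (h2.inter h3)

theorem carlesonBox_eq (θ h : ℝ) (hh : h ∈ Set.Ioc (0 : ℝ) 1) :
    carlesonBox θ h = (rotation (Circle.exp (-θ))) ⁻¹' argBox h := by
  ext z
  simp only [carlesonBox, argBox, Set.mem_setOf_eq, Set.mem_preimage, LinearIsometryEquiv.norm_map]
  refine and_congr_right fun hz1 => and_congr_right fun hz2 => ?_
  have hz : 0 < ‖z‖ := by linarith [hh.2]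
  have hrot : rotation (Circle.exp (-θ)) z = Complex.exp (-θ * Complex.I) * z := by
    rw [rotation_apply, Circle.coe_exp]
    push_cast
    rfl
  rw [hrot]
  constructor
  · rintro ⟨t, ht, hzt⟩
    have e : Complex.exp (-θ * Complex.I) * z
        = (‖z‖ : ℂ) * Complex.exp (((t - θ : ℝ) : ℂ) * Complex.I) := by
      conv_lhs => rw [hzt]
      rw [mul_left_comm, ← Complex.exp_add]
      congr 2
      push_cast
      ring
    have hlt : |t - θ| < Real.pi := ht.trans_le (by nlinarith [Real.pi_pos, hh.2])
    rw [abs_lt] at hlt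
    rw [e, Complex.exp_mul_I, Complex.arg_mul_cos_add_sin_mul_I hz ⟨hlt.1, hlt.2.le⟩]
    exact ht
  · intro ha
    refine ⟨Complex.arg (Complex.exp (-θ * Complex.I) * z) + θ, by simpa using ha, ?_⟩
    have e := Complex.norm_mul_exp_arg_mul_I (Complex.exp (-θ * Complex.I) * z)
    have n1 : ‖Complex.exp (-θ * Complex.I) * z‖ = ‖z‖ := by
      rw [← hrot, LinearIsometryEquiv.norm_map]
    rw [n1] at e
    set a := Complex.arg (Complex.exp (-θ * Complex.I) * z)
    have : Complex.exp (Complex.I * ((a + θ : ℝ) : ℂ))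
        = Complex.exp (a * Complex.I) * Complex.exp (θ * Complex.I) := by
      rw [← Complex.exp_add]; congr 1; push_cast; ring
    rw [this, ← mul_assoc, e, mul_right_comm, ← Complex.exp_add]
    simp

theorem lintegral_radial (p : ℝ) (hp1 : p < 1) (h : ℝ) (hh : 0 < h) :
    ∫⁻ r in Set.Ioo (1 - h) 1, ENNReal.ofReal ((1 - r) ^ (-p))
      = ENNReal.ofReal (h ^ (1 - p) / (1 - p)) := by
  have hle : 1 - h ≤ 1 := by linarith
  have hint : IntervalIntegrable (fun r : ℝ => (1 - r) ^ (-p)) volume (1 - h) 1 := by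
    have := (intervalIntegral.intervalIntegrable_rpow' (a := h) (b := 0)
      (r := -p) (by linarith)).comp_sub_left 1
    simpa using this
  rw [← setLIntegral_congr Ioo_ae_eq_Ioc.symm, ← ofReal_integral_eq_lintegral_ofReal]
  · rw [← intervalIntegral.integral_of_le hle,
      intervalIntegral.integral_comp_sub_left (fun x : ℝ => x ^ (-p)) 1,
      integral_rpow (Or.inl (by linarith))]
    have : -p + 1 ≠ 0 := by linarith
    simp only [sub_self, sub_sub_cancel, Real.zero_rpow this, sub_zero]
    rw [neg_add_eq_sub]
  · exact (intervalIntegrable_iff_integrableOn_Ioc_of_le hle).1 hint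
  · filter_upwards [ae_restrict_mem measurableSet_Ioc] with r hr
    exact Real.rpow_nonneg (by linarith [hr.2]) _

theorem lintegral_argBox_le (p : ℝ) (hp1 : p < 1) (h : ℝ) (hh : h ∈ Set.Ioc (0 : ℝ) 1) :
    ∫⁻ z in argBox h, ENNReal.ofReal ((1 - ‖z‖) ^ (-p))
      ≤ ENNReal.ofReal (2 * Real.pi / (1 - p) * h ^ (2 - p)) := by
  have hm : Measurable fun r : ℝ => ENNReal.ofReal ((1 - r) ^ (-p)) := by fun_prop
  have hprod : ∫⁻ q in Set.Ioo (1 - h) 1 ×ˢ Set.Ioo (-(Real.pi * h)) (Real.pi * h),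
      ENNReal.ofReal ((1 - q.1) ^ (-p)) * 1
      = ENNReal.ofReal (2 * Real.pi / (1 - p) * h ^ (2 - p)) := by
    rw [Measure.volume_eq_prod, ← Measure.prod_restrict,
      lintegral_prod_mul (f := fun r : ℝ => ENNReal.ofReal ((1 - r) ^ (-p)))
        (g := fun _ : ℝ => (1 : ℝ≥0∞)) hm.aemeasurable aemeasurable_const,
      lintegral_radial p hp1 h hh.1]
    simp only [lintegral_const, one_mul, Measure.restrict_apply_univ, Real.volume_Ioo]
    have h0 : 0 ≤ h ^ (1 - p) / (1 - p) :=
      div_nonneg (Real.rpow_nonneg hh.1.le _) (by linarith)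
    rw [← ENNReal.ofReal_mul h0]
    congr 1
    have : h ^ (2 - p) = h ^ (1 - p) * h := by
      rw [show 2 - p = (1 - p) + 1 by ring, Real.rpow_add_one hh.1.ne']
    rw [this]; ring
  rw [← lintegral_indicator (measurableSet_argBox h), ← Complex.lintegral_comp_polarCoord_symm,
    ← hprod, ← lintegral_indicator (measurableSet_Ioo.prod measurableSet_Ioo),
    ← lintegral_indicator polarCoord.open_target.measurableSet]
  refine lintegral_mono fun q => ?_
  by_cases hq : q ∈ polarCoord.target
  · rw [Set.indicator_of_mem hq]
    rw [polarCoord_target] at hq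
    obtain ⟨hq1, hq2⟩ := hq
    have hq1 : 0 < q.1 := hq1
    have hn : ‖Complex.polarCoord.symm q‖ = q.1 := by
      rw [Complex.norm_polarCoord_symm, abs_of_pos hq1]
    by_cases hb : Complex.polarCoord.symm q ∈ argBox h
    · rw [Set.indicator_of_mem hb]
      obtain ⟨b1, b2, b3⟩ := hb
      rw [hn] at b1 b2
      have ha : Complex.arg (Complex.polarCoord.symm q) = q.2 := by
        rw [Complex.polarCoord_symm_apply]
        have := Complex.arg_mul_cos_add_sin_mul_I hq1 (θ := q.2) ⟨hq2.1, hq2.2.le⟩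
        simpa using this
      rw [ha, abs_lt] at b3
      rw [Set.indicator_of_mem (show q ∈ Set.Ioo (1 - h) 1 ×ˢ
        Set.Ioo (-(Real.pi * h)) (Real.pi * h) from ⟨⟨b1, b2⟩, b3⟩), hn, smul_eq_mul, mul_comm]
      gcongr
      exact ENNReal.ofReal_le_one.2 b2.le
    · rw [Set.indicator_of_notMem hb]; simp
  · rw [Set.indicator_of_notMem hq]; exact zero_le

theorem lintegral_carlesonBox_le (p : ℝ) (hp1 : p < 1) (θ h : ℝ) (hh : h ∈ Set.Ioc (0 : ℝ) 1) :
    ∫⁻ z in carlesonBox θ h, ENNReal.ofReal ((1 - ‖z‖) ^ (-p))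
      ≤ ENNReal.ofReal (2 * Real.pi / (1 - p) * h ^ (2 - p)) := by
  refine le_trans (le_of_eq ?_) (lintegral_argBox_le p hp1 h hh)
  have hf : Measurable fun z : ℂ => ENNReal.ofReal ((1 - ‖z‖) ^ (-p)) := by fun_prop
  rw [carlesonBox_eq θ h hh, ← ((rotation (Circle.exp (-θ))).measurePreserving).setLIntegral_comp_preimage
    (measurableSet_argBox h) hf]
  simp only [LinearIsometryEquiv.norm_map]

theorem pointwise_bound (p : ℝ) (hp0 : 0 < p) (x r h : ℝ) (hx : 0 ≤ x) (hr0 : 0 ≤ r) (hr : r < 1)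
    (hh : 0 < h) :
    x ≤ h ^ (1 - p) * (x ^ 2 * (1 - r ^ 2) ^ p) + h ^ (p - 1) * (1 - r) ^ (-p) := by
  have hA : 0 < h ^ (1 - p) := Real.rpow_pos_of_pos hh _
  have hw : 0 < (1 - r) ^ p := Real.rpow_pos_of_pos (by linarith) _
  have hw2 : (1 - r) ^ p ≤ (1 - r ^ 2) ^ p :=
    Real.rpow_le_rpow (by linarith) (by nlinarith) hp0.le
  have e1 : h ^ (p - 1) = (h ^ (1 - p))⁻¹ := by rw [← Real.rpow_neg hh.le]; congr 1; ring
  rw [e1, Real.rpow_neg (by linarith), ← mul_inv]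
  set A := h ^ (1 - p)
  set w := (1 - r) ^ p
  have hc : 0 < A * w := by positivity
  have key : x ≤ (A * w) * x ^ 2 + (A * w)⁻¹ := by
    set c := A * w
    have : c * x ^ 2 + c⁻¹ - x = c * (x - c⁻¹ / 2) ^ 2 + 3 / 4 * c⁻¹ := by
      field_simp; ring
    have : 0 ≤ c * (x - c⁻¹ / 2) ^ 2 + 3 / 4 * c⁻¹ := by positivity
    linarith
  have : A * w * x ^ 2 ≤ A * (x ^ 2 * (1 - r ^ 2) ^ p) := by
    rw [mul_assoc, mul_comm w]; gcongr
  linarith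

/-- For `0 < p < 1`: if `|g(z)|² (1-|z|²)^p dA(z)` is a `p`-Carleson measure, then
`|g(z)| dA(z)` is a (1-)Carleson measure. -/
theorem carleson_of_pCarleson (p : ℝ) (hp0 : 0 < p) (hp1 : p < 1)
    (g : ℂ → ℂ) (hg : Measurable g)
    (h : IsPCarleson p (diskMeasure fun z => ‖g z‖ ^ 2 * (1 - ‖z‖ ^ 2) ^ p)) :
    IsPCarleson 1 (diskMeasure fun z => ‖g z‖) := by
  obtain ⟨C, hC⟩ := h
  refine ⟨max C 0 + 2 * Real.pi / (1 - p), fun θ k hk => ?_⟩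
  have hk0 : 0 < k := hk.1
  have hsub : carlesonBox θ k ⊆ unitDisk := fun z hz => by
    simpa [unitDisk] using hz.2.1
  have hmeas : MeasurableSet (carlesonBox θ k) := by
    rw [carlesonBox_eq θ k hk]
    exact (rotation (Circle.exp (-θ))).continuous.measurable (measurableSet_argBox k)
  have hCk := hC θ k hk
  rw [diskMeasure, withDensity_apply _ hmeas, Measure.restrict_restrict hmeas,
    Set.inter_eq_left.2 hsub] at hCk ⊢
  have hA : 0 ≤ k ^ (1 - p) := Real.rpow_nonneg hk0.le _
  have hB : 0 ≤ k ^ (p - 1) := Real.rpow_nonneg hk0.le _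
  have hK : 0 ≤ 2 * Real.pi / (1 - p) := div_nonneg (by positivity) (by linarith)
  have m1 : Measurable fun z : ℂ => ENNReal.ofReal (‖g z‖ ^ 2 * (1 - ‖z‖ ^ 2) ^ p) := by fun_prop
  have m2 : Measurable fun z : ℂ => ENNReal.ofReal ((1 - ‖z‖) ^ (-p)) := by fun_prop
  calc ∫⁻ z in carlesonBox θ k, ENNReal.ofReal ‖g z‖
      ≤ ∫⁻ z in carlesonBox θ k,
          (ENNReal.ofReal (k ^ (1 - p)) * ENNReal.ofReal (‖g z‖ ^ 2 * (1 - ‖z‖ ^ 2) ^ p)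
            + ENNReal.ofReal (k ^ (p - 1)) * ENNReal.ofReal ((1 - ‖z‖) ^ (-p))) := by
        refine setLIntegral_mono' hmeas fun z hz => ?_
        rw [← ENNReal.ofReal_mul hA, ← ENNReal.ofReal_mul hB]
        refine le_trans (ENNReal.ofReal_le_ofReal (pointwise_bound p hp0 ‖g z‖ ‖z‖ k
          (norm_nonneg _) (norm_nonneg _) hz.2.1 hk0)) ENNReal.ofReal_add_le
    _ = ENNReal.ofReal (k ^ (1 - p)) *
          (∫⁻ z in carlesonBox θ k, ENNReal.ofReal (‖g z‖ ^ 2 * (1 - ‖z‖ ^ 2) ^ p))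
        + ENNReal.ofReal (k ^ (p - 1)) *
          ∫⁻ z in carlesonBox θ k, ENNReal.ofReal ((1 - ‖z‖) ^ (-p)) := by
        rw [lintegral_add_left (m1.const_mul _), lintegral_const_mul _ m1,
          lintegral_const_mul _ m2]
    _ ≤ ENNReal.ofReal (k ^ (1 - p)) * ENNReal.ofReal (max C 0 * k ^ p)
        + ENNReal.ofReal (k ^ (p - 1)) *
          ENNReal.ofReal (2 * Real.pi / (1 - p) * k ^ (2 - p)) := by
        gcongr
        · refine hCk.trans (ENNReal.ofReal_le_ofReal ?_)
          exact mul_le_mul_of_nonneg_right (le_max_left _ _) (Real.rpow_nonneg hk0.le _)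
        · exact lintegral_carlesonBox_le p hp1 θ k hk
    _ = ENNReal.ofReal ((max C 0 + 2 * Real.pi / (1 - p)) * k ^ (1 : ℝ)) := by
        have e1 : k ^ (1 - p) * k ^ p = k ^ (1 : ℝ) := by
          rw [← Real.rpow_add hk0]; congr 1; ring
        have e2 : k ^ (p - 1) * k ^ (2 - p) = k ^ (1 : ℝ) := by
          rw [← Real.rpow_add hk0]; congr 1; ring
        rw [← ENNReal.ofReal_mul hA, ← ENNReal.ofReal_mul hB, ← ENNReal.ofReal_add
          (by positivity) (mul_nonneg hB (mul_nonneg hK (Real.rpow_nonneg hk0.le _)))]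
        congr 1
        rw [mul_left_comm, e1, mul_left_comm, e2]
        ring

end
end

section
/- Let p > 0. An analytic function g on the unit disk D belongs to the multiplier algebra M(Q_p) if and only if g ∈ H^∞(D) and, for every f ∈ Q_p, the measure |f(z)|^2 |g'(z)|^2 (1 - |z|^2)^p dA(z) is a p-Carleson measure on D. -/
open MeasureTheory Complex Metric Set Filter
open scoped ENNReal Real

noncomputable section

lemma mem_disk {z : ℂ} : z ∈ unitDisk ↔ ‖z‖ < 1 := by
  simp [unitDisk]

lemma isOpen_disk : IsOpen unitDisk := Metric.isOpen_ball

lemma measurableSet_disk : MeasurableSet unitDisk := isOpen_disk.measurableSet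

lemma norm_den_ge {a z : ℂ} (hz : ‖z‖ < 1) :
    1 - ‖a‖ ≤ ‖1 - (starRingEnd ℂ) a * z‖ := by
  have h1 : ‖(starRingEnd ℂ) a * z‖ ≤ ‖a‖ := by
    rw [norm_mul, Complex.norm_conj]
    nlinarith [norm_nonneg a]
  have h2 := norm_sub_norm_le (1 : ℂ) ((starRingEnd ℂ) a * z)
  rw [norm_one] at h2
  linarith

lemma norm_den_ge' {a z : ℂ} (ha : ‖a‖ < 1) :
    1 - ‖z‖ ≤ ‖1 - (starRingEnd ℂ) a * z‖ := by
  have h1 : ‖(starRingEnd ℂ) a * z‖ ≤ ‖z‖ := by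
    rw [norm_mul, Complex.norm_conj]
    nlinarith [norm_nonneg z]
  have h2 := norm_sub_norm_le (1 : ℂ) ((starRingEnd ℂ) a * z)
  rw [norm_one] at h2
  linarith

lemma norm_den_pos {a z : ℂ} (ha : ‖a‖ < 1) (hz : ‖z‖ < 1) :
    0 < ‖1 - (starRingEnd ℂ) a * z‖ :=
  lt_of_lt_of_le (by linarith) (norm_den_ge hz)

lemma den_ne {a z : ℂ} (ha : ‖a‖ < 1) (hz : ‖z‖ < 1) :
    1 - (starRingEnd ℂ) a * z ≠ 0 := norm_pos_iff.1 (norm_den_pos ha hz)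

lemma one_sub_moebius {a z : ℂ} (ha : ‖a‖ < 1) (hz : ‖z‖ < 1) :
    1 - ‖moebius a z‖ ^ 2 =
      (1 - ‖a‖ ^ 2) * (1 - ‖z‖ ^ 2) / ‖1 - (starRingEnd ℂ) a * z‖ ^ 2 := by
  have h := norm_den_pos ha hz
  rw [moebius, norm_div, div_pow, eq_div_iff (by positivity), sub_mul,
    div_mul_cancel₀ _ (by positivity)]
  simp only [← Complex.normSq_eq_norm_sq, Complex.normSq_apply]
  simp
  ring

lemma one_sub_moebius_nonneg {a z : ℂ} (ha : ‖a‖ < 1) (hz : ‖z‖ < 1) :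
    0 ≤ 1 - ‖moebius a z‖ ^ 2 := by
  rw [one_sub_moebius ha hz]
  have h1 : 0 ≤ 1 - ‖a‖ ^ 2 := by nlinarith [norm_nonneg a]
  have h2 : 0 ≤ 1 - ‖z‖ ^ 2 := by nlinarith [norm_nonneg z]
  positivity

lemma norm_moebius_le {a z : ℂ} (ha : ‖a‖ < 1) (hz : ‖z‖ < 1) : ‖moebius a z‖ ≤ 1 := by
  have := one_sub_moebius_nonneg ha hz
  nlinarith [norm_nonneg (moebius a z)]

lemma norm_moebius_lt {a z : ℂ} (ha : ‖a‖ < 1) (hz : ‖z‖ < 1) : ‖moebius a z‖ < 1 := by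
  have h0 : 0 < 1 - ‖moebius a z‖ ^ 2 := by
    rw [one_sub_moebius ha hz]
    have h1 : 0 < 1 - ‖a‖ ^ 2 := by nlinarith [norm_nonneg a]
    have h2 : 0 < 1 - ‖z‖ ^ 2 := by nlinarith [norm_nonneg z]
    have := norm_den_pos ha hz
    positivity
  nlinarith [norm_nonneg (moebius a z)]

lemma hasDerivAt_moebius {a z : ℂ} (ha : ‖a‖ < 1) (hz : ‖z‖ < 1) :
    HasDerivAt (moebius a) (-((1 - ‖a‖ ^ 2 : ℝ) : ℂ) / (1 - (starRingEnd ℂ) a * z) ^ 2) z := by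
  have h := den_ne ha hz
  have h1 : HasDerivAt (fun z : ℂ => a - z) (-1) z := by
    simpa using (hasDerivAt_id z).const_sub a
  have h2 : HasDerivAt (fun z : ℂ => 1 - (starRingEnd ℂ) a * z) (-(starRingEnd ℂ) a) z := by
    simpa using ((hasDerivAt_id z).const_mul ((starRingEnd ℂ) a)).const_sub 1
  have h3 := h1.div h2 h
  refine h3.congr_deriv ?_
  congr 1
  have : ((‖a‖ ^ 2 : ℝ) : ℂ) = (starRingEnd ℂ) a * a := by
    rw [Complex.conj_mul']; push_cast; rfl
  rw [Complex.ofReal_sub, this]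
  push_cast
  ring

lemma moebius_diff {a : ℂ} (ha : ‖a‖ < 1) : DifferentiableOn ℂ (moebius a) unitDisk :=
  fun _ hz => (hasDerivAt_moebius ha (mem_disk.1 hz)).differentiableAt.differentiableWithinAt

lemma norm_deriv_moebius {a z : ℂ} (ha : ‖a‖ < 1) (hz : ‖z‖ < 1) :
    ‖deriv (moebius a) z‖ = (1 - ‖a‖ ^ 2) / ‖1 - (starRingEnd ℂ) a * z‖ ^ 2 := by
  rw [(hasDerivAt_moebius ha hz).deriv, norm_div, norm_neg, Complex.norm_real, norm_pow,
    Real.norm_of_nonneg]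
  nlinarith [norm_nonneg a]

lemma norm_deriv_moebius_mul_le {a z : ℂ} (ha : ‖a‖ < 1) (hz : ‖z‖ < 1) :
    (1 - ‖z‖ ^ 2) * ‖deriv (moebius a) z‖ ≤ 1 := by
  have h := one_sub_moebius ha hz
  have : (1 - ‖z‖ ^ 2) * ‖deriv (moebius a) z‖ = 1 - ‖moebius a z‖ ^ 2 := by
    rw [h, norm_deriv_moebius ha hz]; ring
  rw [this]
  nlinarith [sq_nonneg ‖moebius a z‖]

lemma deriv_moebius_self {a : ℂ} (ha : ‖a‖ < 1) :
    (1 - ‖a‖ ^ 2) * ‖deriv (moebius a) a‖ = 1 := by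
  have h1 : 0 < 1 - ‖a‖ ^ 2 := by nlinarith [norm_nonneg a]
  have : 1 - (starRingEnd ℂ) a * a = ((1 - ‖a‖ ^ 2 : ℝ) : ℂ) := by
    rw [Complex.conj_mul']; push_cast; rfl
  rw [norm_deriv_moebius ha ha, this, Complex.norm_real, Real.norm_of_nonneg h1.le]
  field_simp

lemma moebius_injOn {a : ℂ} (ha : ‖a‖ < 1) : Set.InjOn (moebius a) unitDisk := by
  intro z hz w hw h
  have hz' := den_ne ha (mem_disk.1 hz)
  have hw' := den_ne ha (mem_disk.1 hw)
  rw [moebius, moebius, div_eq_div_iff hz' hw'] at h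
  have h1 : (w - z) * (1 - (starRingEnd ℂ) a * a) = 0 := by linear_combination h
  rcases mul_eq_zero.1 h1 with h2 | h2
  · exact (sub_eq_zero.1 h2).symm
  · exact absurd h2 (den_ne ha ha)

lemma det_mul_complex (c : ℂ) :
    ((ContinuousLinearMap.restrictScalars ℝ
      (ContinuousLinearMap.toSpanSingleton ℂ c) : ℂ →L[ℝ] ℂ)).det = ‖c‖ ^ 2 := by
  have : ((ContinuousLinearMap.restrictScalars ℝ
      (ContinuousLinearMap.toSpanSingleton ℂ c) : ℂ →L[ℝ] ℂ)).det =
      LinearMap.det (LinearMap.restrictScalars ℝ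
        ((ContinuousLinearMap.toSpanSingleton ℂ c : ℂ →L[ℂ] ℂ) : ℂ →ₗ[ℂ] ℂ)) := rfl
  rw [this, LinearMap.det_restrictScalars, LinearMap.det_ring]
  simp [Algebra.norm_complex_eq, Complex.normSq_eq_norm_sq]

lemma area_moebius {a : ℂ} (ha : ‖a‖ < 1) :
    ∫⁻ z in unitDisk, ENNReal.ofReal (‖deriv (moebius a) z‖ ^ 2) ≤ ENNReal.ofReal Real.pi := by
  have h := MeasureTheory.lintegral_abs_det_fderiv_eq_addHaar_image (volume : Measure ℂ)
    (s := unitDisk) (f := moebius a)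
    (f' := fun z => ContinuousLinearMap.restrictScalars ℝ
      (ContinuousLinearMap.toSpanSingleton ℂ (deriv (moebius a) z))) measurableSet_disk
    (fun z hz => ((hasDerivAt_moebius ha (mem_disk.1 hz)).differentiableAt.hasDerivAt.hasFDerivAt
      ).restrictScalars ℝ |>.hasFDerivWithinAt) (moebius_injOn ha)
  simp only [det_mul_complex, abs_pow, abs_norm] at h
  rw [h]
  calc volume (moebius a '' unitDisk) ≤ volume (Metric.ball (0 : ℂ) 1) := by
        apply measure_mono
        rintro _ ⟨z, hz, rfl⟩
        simpa using norm_moebius_lt ha (mem_disk.1 hz)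
    _ = ENNReal.ofReal Real.pi := by
        rw [Complex.volume_ball]; simp
        rw [← NNReal.coe_real_pi, ENNReal.ofReal_coe_nnreal]
    _ ≤ _ := le_rfl

lemma measurable_moebius (a : ℂ) : Measurable (moebius a) := by
  unfold moebius; fun_prop

lemma measurable_qp (p : ℝ) (f : ℂ → ℂ) (a : ℂ) : Measurable
    (fun z => ENNReal.ofReal (‖deriv f z‖ ^ 2 * (1 - ‖moebius a z‖ ^ 2) ^ p)) := by
  have h1 := measurable_deriv f
  have h2 := measurable_moebius a
  fun_prop

lemma circle_mean {F : ℂ → ℂ} {c : ℂ} {r : ℝ} (hF : DifferentiableOn ℂ F (Metric.ball c r))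
    {w : ℂ} (hw : ‖w‖ < r) :
    ENNReal.ofReal (2 * Real.pi) * ENNReal.ofReal (‖F c‖ ^ 2) ≤
      ∫⁻ t in Set.Ioc (0 : ℝ) (2 * Real.pi),
        ENNReal.ofReal (‖F (c + circleMap 0 1 t * w)‖ ^ 2) := by
  have hmaps : ∀ ζ ∈ Metric.closedBall (0 : ℂ) 1, c + ζ * w ∈ Metric.ball c r := by
    intro ζ hζ
    have : ‖ζ‖ ≤ 1 := by simpa using hζ
    simp only [mem_ball, dist_self_add_left, norm_mul]
    nlinarith [norm_nonneg w, norm_nonneg ζ]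
  have hd : DifferentiableOn ℂ (fun ζ : ℂ => F (c + ζ * w) ^ 2) (Metric.closedBall 0 1) := by
    refine DifferentiableOn.pow ?_ 2
    exact hF.comp (by fun_prop) hmaps
  have h1 : DiffContOnCl ℂ (fun ζ : ℂ => F (c + ζ * w) ^ 2) (Metric.ball 0 |(1 : ℝ)|) := by
    apply DifferentiableOn.diffContOnCl
    rw [abs_one, closure_ball _ one_ne_zero]
    exact hd
  have h2 := h1.circleAverage
  simp only [Real.circleAverage, zero_mul, add_zero] at h2
  have hpi : (0 : ℝ) < 2 * Real.pi := by positivity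
  have h3 : ∫ t in Set.Ioc (0 : ℝ) (2 * Real.pi), F (c + circleMap 0 1 t * w) ^ 2
      = (2 * Real.pi) • F c ^ 2 := by
    rw [← intervalIntegral.integral_of_le hpi.le, ← h2, smul_smul, mul_inv_cancel₀ hpi.ne', one_smul]
  have h4 := enorm_integral_le_lintegral_enorm (μ := volume.restrict (Set.Ioc (0 : ℝ) (2 * Real.pi)))
    (fun t => F (c + circleMap 0 1 t * w) ^ 2)
  rw [h3] at h4
  have e1 : ∀ x : ℂ, ‖x ^ 2‖ₑ = ENNReal.ofReal (‖x‖ ^ 2) := by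
    intro x; rw [← ofReal_norm, norm_pow]
  simp only [e1] at h4
  rw [← ENNReal.ofReal_mul hpi.le]
  refine le_trans (le_of_eq ?_) h4
  rw [← ofReal_norm, norm_smul, norm_pow, Real.norm_of_nonneg hpi.le]

lemma rot_integral {G : ℂ → ℝ≥0∞} (hG : Measurable G) (t : ℝ) :
    ∫⁻ w, G (circleMap 0 1 t * w) = ∫⁻ w, G w := by
  have hn : ‖circleMap 0 1 t‖ = 1 := by simp
  have h := (rotation (Circle.exp t)).measurePreserving.lintegral_comp hG
  rw [← h]
  congr 1
  ext w
  simp [rotation_apply, circleMap]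

lemma area_mean {F : ℂ → ℂ} {c : ℂ} {r : ℝ} (hFm : Measurable F)
    (hF : DifferentiableOn ℂ F (Metric.ball c r)) :
    ENNReal.ofReal (‖F c‖ ^ 2) * volume (Metric.ball c r) ≤
      ∫⁻ z in Metric.ball c r, ENNReal.ofReal (‖F z‖ ^ 2) := by
  have hpi : (0 : ℝ) < 2 * Real.pi := by positivity
  set G : ℂ → ℝ≥0∞ := (Metric.ball (0 : ℂ) r).indicator
    (fun w => ENNReal.ofReal (‖F (c + w)‖ ^ 2)) with hGdef
  have hGm : Measurable G := by
    refine Measurable.indicator ?_ measurableSet_ball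
    have : Measurable fun w => F (c + w) := hFm.comp (by fun_prop)
    fun_prop
  have hI : ∫⁻ z in Metric.ball c r, ENNReal.ofReal (‖F z‖ ^ 2) = ∫⁻ w, G w := by
    rw [← lintegral_indicator measurableSet_ball,
      ← lintegral_add_left_eq_self _ c]
    congr 1
    ext w
    simp only [hGdef, Set.indicator, mem_ball, dist_self_add_left, dist_zero_right]
  have hsw : ∫⁻ t in Set.Ioc (0 : ℝ) (2 * Real.pi), ∫⁻ w, G (circleMap 0 1 t * w) =
      ∫⁻ w, ∫⁻ t in Set.Ioc (0 : ℝ) (2 * Real.pi), G (circleMap 0 1 t * w) := by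
    refine lintegral_lintegral_swap (Measurable.aemeasurable ?_)
    refine hGm.comp ?_
    have : Continuous (circleMap 0 1) := continuous_circleMap 0 1
    exact (by fun_prop : Continuous fun q : ℝ × ℂ => circleMap 0 1 q.1 * q.2).measurable
  simp only [rot_integral hGm] at hsw
  rw [setLIntegral_const, Real.volume_Ioc, sub_zero] at hsw
  have hlow : ENNReal.ofReal (2 * Real.pi) * ENNReal.ofReal (‖F c‖ ^ 2) * volume (Metric.ball c r) ≤
      ∫⁻ w, ∫⁻ t in Set.Ioc (0 : ℝ) (2 * Real.pi), G (circleMap 0 1 t * w) := by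
    have : volume (Metric.ball c r) = volume (Metric.ball (0 : ℂ) r) := by
      simp [Complex.volume_ball]
    rw [this, ← lintegral_indicator_const measurableSet_ball]
    refine lintegral_mono fun w => ?_
    by_cases hw : w ∈ Metric.ball (0 : ℂ) r
    · have hw' : ‖w‖ < r := by simpa using hw
      rw [Set.indicator_of_mem hw]
      refine (circle_mean hF hw').trans (le_of_eq ?_)
      congr 1
      ext t
      have : circleMap 0 1 t * w ∈ Metric.ball (0 : ℂ) r := by simpa using hw'
      rw [hGdef, Set.indicator_of_mem this]
    · rw [Set.indicator_of_notMem hw]; exact zero_le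
  rw [hI]
  rw [← hsw, mul_comm (∫⁻ w, G w), mul_assoc] at hlow
  exact (ENNReal.mul_le_mul_iff_right (ENNReal.ofReal_pos.2 hpi).ne' ENNReal.ofReal_ne_top).1 hlow

lemma bloch_of_qp {p : ℝ} (hp : 0 < p) {f : ℂ → ℂ} (hf : MemQp p f) :
    ∃ B : ℝ, ∀ a ∈ unitDisk, (1 - ‖a‖ ^ 2) * ‖deriv f a‖ ≤ B := by
  obtain ⟨hd, -, C, hC⟩ := hf
  have hd' : DifferentiableOn ℂ (deriv f) unitDisk := hd.deriv isOpen_disk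
  set K : ℝ := (2 / 25 : ℝ) ^ p with hK
  have hKpos : 0 < K := by positivity
  refine ⟨Real.sqrt (16 * (max C 0 / K) / Real.pi), fun a ha => ?_⟩
  have ha1 := mem_disk.1 ha
  set r : ℝ := (1 - ‖a‖) / 2 with hr
  have hrpos : 0 < r := by rw [hr]; linarith
  have hsub : Metric.ball a r ⊆ unitDisk := by
    intro z hz
    rw [mem_disk]
    have h1 : ‖z - a‖ < r := by simpa [dist_eq_norm] using hz
    have h2 : ‖z‖ ≤ ‖a‖ + ‖z - a‖ := by simpa using norm_add_le a (z - a)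
    linarith
  have hlow : ∀ z ∈ Metric.ball a r, K ≤ (1 - ‖moebius a z‖ ^ 2) ^ p := by
    intro z hz
    have hz1 := mem_disk.1 (hsub hz)
    refine Real.rpow_le_rpow (by norm_num) ?_ hp.le
    rw [one_sub_moebius ha1 hz1]
    have h1 : ‖z - a‖ < r := by simpa [dist_eq_norm] using hz
    have h2 : ‖z‖ ≤ ‖a‖ + ‖z - a‖ := by simpa using norm_add_le a (z - a)
    have h3 : ‖1 - (starRingEnd ℂ) a * z‖ ≤ 5 * r := by
      have e : 1 - (starRingEnd ℂ) a * z =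
          ((1 - ‖a‖ ^ 2 : ℝ) : ℂ) - (starRingEnd ℂ) a * (z - a) := by
        have : ((‖a‖ ^ 2 : ℝ) : ℂ) = (starRingEnd ℂ) a * a := by
          rw [Complex.conj_mul']; push_cast; rfl
        rw [Complex.ofReal_sub, this]; push_cast; ring
      rw [e]
      refine (norm_sub_le _ _).trans ?_
      rw [Complex.norm_real, norm_mul, Complex.norm_conj,
        Real.norm_of_nonneg (by nlinarith [norm_nonneg a])]
      nlinarith [norm_nonneg a, norm_nonneg (z - a)]
    have h4 := norm_den_pos ha1 hz1
    rw [le_div_iff₀ (by positivity)]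
    have h5 : 2 * r ≤ 1 - ‖a‖ ^ 2 := by nlinarith [norm_nonneg a]
    have h6 : r ≤ 1 - ‖z‖ ^ 2 := by nlinarith [norm_nonneg z]
    have h7 : ‖1 - (starRingEnd ℂ) a * z‖ ^ 2 ≤ (5 * r) ^ 2 := by gcongr
    have h8 : (2 * r) * r ≤ (1 - ‖a‖ ^ 2) * (1 - ‖z‖ ^ 2) := by gcongr; linarith
    nlinarith
  have h1 := area_mean (measurable_deriv f) (hd'.mono hsub)
  have h2 : ENNReal.ofReal K * ∫⁻ z in Metric.ball a r, ENNReal.ofReal (‖deriv f z‖ ^ 2) ≤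
      ENNReal.ofReal (max C 0) := by
    rw [← lintegral_const_mul' _ _ ENNReal.ofReal_ne_top]
    calc _ ≤ ∫⁻ z in Metric.ball a r,
          ENNReal.ofReal (‖deriv f z‖ ^ 2 * (1 - ‖moebius a z‖ ^ 2) ^ p) := by
          refine setLIntegral_mono' measurableSet_ball fun z hz => ?_
          rw [← ENNReal.ofReal_mul hKpos.le, mul_comm]
          exact ENNReal.ofReal_le_ofReal (mul_le_mul_of_nonneg_left (hlow z hz) (sq_nonneg _))
      _ ≤ qpIntegral p f a := lintegral_mono_set hsub
      _ ≤ ENNReal.ofReal C := hC a ha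
      _ ≤ _ := ENNReal.ofReal_le_ofReal (le_max_left _ _)
  have hvol : volume (Metric.ball a r) = ENNReal.ofReal (r ^ 2 * Real.pi) := by
    rw [Complex.volume_ball, ENNReal.ofReal_mul (by positivity), ENNReal.ofReal_pow hrpos.le,
      ← NNReal.coe_real_pi, ENNReal.ofReal_coe_nnreal]
  have h3 : ENNReal.ofReal (K * (‖deriv f a‖ ^ 2 * (r ^ 2 * Real.pi))) ≤
      ENNReal.ofReal (max C 0) := by
    rw [ENNReal.ofReal_mul hKpos.le, ENNReal.ofReal_mul (by positivity), ← hvol]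
    exact (mul_le_mul_right h1 _).trans h2
  rw [ENNReal.ofReal_le_ofReal_iff (le_max_right _ _)] at h3
  apply Real.le_sqrt_of_sq_le
  have h4 : (1 - ‖a‖ ^ 2) ≤ 4 * r := by nlinarith [norm_nonneg a]
  have h5 : 0 ≤ 1 - ‖a‖ ^ 2 := by nlinarith [norm_nonneg a]
  rw [le_div_iff₀ Real.pi_pos, ← mul_div_assoc, le_div_iff₀ hKpos]
  calc ((1 - ‖a‖ ^ 2) * ‖deriv f a‖) ^ 2 * Real.pi * K
      ≤ ((4 * r) * ‖deriv f a‖) ^ 2 * Real.pi * K := by gcongr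
    _ = 16 * (K * (‖deriv f a‖ ^ 2 * (r ^ 2 * Real.pi))) := by ring
    _ ≤ _ := by linarith

lemma h2Bounded_of_bdd {f : ℂ → ℂ} {M : ℝ} (hM : ∀ z ∈ unitDisk, ‖f z‖ ≤ M) : h2Bounded f := by
  refine ⟨M ^ 2 * |2 * Real.pi - 0|, fun r hr => ?_⟩
  refine (le_abs_self _).trans ?_
  rw [← Real.norm_eq_abs]
  refine intervalIntegral.norm_integral_le_of_norm_le_const fun t _ => ?_
  have hz : (r : ℂ) * Complex.exp (Complex.I * t) ∈ unitDisk := by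
    rw [mem_disk, norm_mul, mul_comm Complex.I, Complex.norm_exp_ofReal_mul_I, Complex.norm_real,
      Real.norm_of_nonneg hr.1, mul_one]
    exact hr.2
  rw [norm_pow, norm_norm]
  have := hM _ hz
  gcongr

lemma series_facts {c : ℕ → ℂ} (hc : Summable fun k => ‖c k‖) {a : ℕ → ℂ}
    (ha : ∀ k, ‖a k‖ < 1) :
    DifferentiableOn ℂ (fun z => ∑' k, c k * moebius (a k) z) unitDisk ∧
    (∀ z ∈ unitDisk, HasSum (fun k => c k * deriv (moebius (a k)) z)
      (deriv (fun z => ∑' k, c k * moebius (a k) z) z)) ∧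
    (∀ z ∈ unitDisk, ‖∑' k, c k * moebius (a k) z‖ ≤ ∑' k, ‖c k‖) := by
  have hb : ∀ k, ∀ w ∈ unitDisk, ‖c k * moebius (a k) w‖ ≤ ‖c k‖ := by
    intro k w hw
    rw [norm_mul]
    exact mul_le_of_le_one_right (norm_nonneg _) (norm_moebius_le (ha k) (mem_disk.1 hw))
  have hd : ∀ k, DifferentiableOn ℂ (fun z => c k * moebius (a k) z) unitDisk :=
    fun k => (moebius_diff (ha k)).const_mul _
  refine ⟨Complex.differentiableOn_tsum_of_summable_norm hc hd isOpen_disk hb, ?_, ?_⟩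
  · intro z hz
    have h := Complex.hasSum_deriv_of_summable_norm hc hd isOpen_disk hb hz
    have e : ∀ k, deriv (fun z => c k * moebius (a k) z) z = c k * deriv (moebius (a k)) z :=
      fun k => deriv_const_mul_field _
    simpa only [e] using h
  · intro z hz
    exact tsum_of_norm_bounded hc.hasSum (fun k => hb k z hz)

lemma qp_series {p : ℝ} (hp : 0 < p) {c : ℕ → ℂ} (hc : Summable fun k => ‖c k‖) {a : ℕ → ℂ}
    (ha : ∀ k, ‖a k‖ < 1) : MemQp p (fun z => ∑' k, c k * moebius (a k) z) := by
  obtain ⟨h1, h2, h3⟩ := series_facts hc ha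
  refine ⟨h1, h2Bounded_of_bdd h3, ?_⟩
  set S : ℝ := ∑' k, ‖c k‖ with hS
  have hS0 : 0 ≤ S := tsum_nonneg fun _ => norm_nonneg _
  set f : ℂ → ℂ := fun z => ∑' k, c k * moebius (a k) z with hf
  refine ⟨S * (S * Real.pi), fun b hb => ?_⟩
  have hb1 := mem_disk.1 hb
  have hpt : ∀ z ∈ unitDisk, ENNReal.ofReal (‖deriv f z‖ ^ 2) ≤ ENNReal.ofReal S *
      ∑' k, ENNReal.ofReal ‖c k‖ * ENNReal.ofReal (‖deriv (moebius (a k)) z‖ ^ 2) := by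
    intro z hz
    have hcont : Continuous fun x : ℂ => ENNReal.ofReal (‖x‖ ^ 2) :=
      ENNReal.continuous_ofReal.comp (by fun_prop)
    refine le_of_tendsto ((hcont.tendsto _).comp (h2 z hz)) (Eventually.of_forall fun s => ?_)
    have e1 : ‖∑ k ∈ s, c k * deriv (moebius (a k)) z‖ ^ 2 ≤
        S * ∑ k ∈ s, ‖c k‖ * ‖deriv (moebius (a k)) z‖ ^ 2 := by
      calc ‖∑ k ∈ s, c k * deriv (moebius (a k)) z‖ ^ 2
          ≤ (∑ k ∈ s, ‖c k‖ * ‖deriv (moebius (a k)) z‖) ^ 2 := by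
            gcongr
            refine (norm_sum_le _ _).trans (le_of_eq ?_)
            simp only [norm_mul]
        _ ≤ (∑ k ∈ s, ‖c k‖) * ∑ k ∈ s, ‖c k‖ * ‖deriv (moebius (a k)) z‖ ^ 2 := by
            refine Finset.sum_sq_le_sum_mul_sum_of_sq_le_mul s (fun _ _ => norm_nonneg _)
              (fun _ _ => by positivity) (fun _ _ => le_of_eq (by ring))
        _ ≤ _ := by
            gcongr
            exact hc.sum_le_tsum s (fun _ _ => norm_nonneg _)
    refine (ENNReal.ofReal_le_ofReal e1).trans ?_
    rw [ENNReal.ofReal_mul hS0, ENNReal.ofReal_sum_of_nonneg (fun _ _ => by positivity)]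
    gcongr
    refine le_trans (le_of_eq ?_) (ENNReal.sum_le_tsum s)
    exact Finset.sum_congr rfl fun k _ => ENNReal.ofReal_mul (norm_nonneg _)
  have hm : ∀ k, Measurable fun z => ENNReal.ofReal ‖c k‖ *
      ENNReal.ofReal (‖deriv (moebius (a k)) z‖ ^ 2) := by
    intro k
    have := measurable_deriv (moebius (a k))
    fun_prop
  calc qpIntegral p f b ≤ ∫⁻ z in unitDisk, ENNReal.ofReal (‖deriv f z‖ ^ 2) := by
        refine setLIntegral_mono' measurableSet_disk fun z hz => ?_
        refine ENNReal.ofReal_le_ofReal ?_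
        refine mul_le_of_le_one_right (by positivity) ?_
        refine Real.rpow_le_one (one_sub_moebius_nonneg hb1 (mem_disk.1 hz)) ?_ hp.le
        linarith [sq_nonneg ‖moebius b z‖]
    _ ≤ ∫⁻ z in unitDisk, ENNReal.ofReal S *
      ∑' k, ENNReal.ofReal ‖c k‖ * ENNReal.ofReal (‖deriv (moebius (a k)) z‖ ^ 2) :=
        setLIntegral_mono' measurableSet_disk hpt
    _ = ENNReal.ofReal S * ∑' k, ENNReal.ofReal ‖c k‖ *
          ∫⁻ z in unitDisk, ENNReal.ofReal (‖deriv (moebius (a k)) z‖ ^ 2) := by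
        rw [lintegral_const_mul' _ _ ENNReal.ofReal_ne_top, lintegral_tsum
          (fun k => (hm k).aemeasurable)]
        congr 2
        ext k
        rw [lintegral_const_mul' _ _ ENNReal.ofReal_ne_top]
    _ ≤ ENNReal.ofReal S * ∑' k, ENNReal.ofReal ‖c k‖ * ENNReal.ofReal Real.pi := by
        gcongr with k
        exact area_moebius (ha k)
    _ = ENNReal.ofReal (S * (S * Real.pi)) := by
        rw [ENNReal.tsum_mul_right, ← ENNReal.ofReal_tsum_of_nonneg (fun _ => norm_nonneg _) hc,
          ENNReal.ofReal_mul hS0, ENNReal.ofReal_mul hS0]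

lemma summable_lp1 (c : lp (fun _ : ℕ => ℂ) 1) : Summable fun k => ‖c k‖ := by
  have := (lp.memℓp c).summable (by simp)
  simpa using this

lemma norm_lp1 (c : lp (fun _ : ℕ => ℂ) 1) : ‖c‖ = ∑' k, ‖c k‖ := by
  rw [lp.norm_eq_tsum_rpow (by simp)]
  simp

lemma exists_functional (u : ℕ → ℂ) (M : ℝ) (hu : ∀ k, ‖u k‖ ≤ M) :
    ∃ Λ : lp (fun _ : ℕ => ℂ) 1 →L[ℂ] ℂ, ∀ c, Λ c = ∑' k, c k * u k := by
  have hb : ∀ (c : lp (fun _ : ℕ => ℂ) 1) k, ‖c k * u k‖ ≤ ‖c k‖ * M := by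
    intro c k
    rw [norm_mul]
    exact mul_le_mul_of_nonneg_left (hu k) (norm_nonneg _)
  have hs : ∀ c : lp (fun _ : ℕ => ℂ) 1, Summable fun k => c k * u k := fun c =>
    Summable.of_norm_bounded ((summable_lp1 c).mul_right M) (hb c)
  refine ⟨LinearMap.mkContinuous
    { toFun := fun c => ∑' k, c k * u k
      map_add' := ?_
      map_smul' := ?_ } M ?_, fun c => rfl⟩
  · intro x y
    rw [← (hs x).tsum_add (hs y)]
    congr 1; ext k
    simp [add_mul]
  · intro m x
    simp only [RingHom.id_apply, smul_eq_mul]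
    rw [← tsum_mul_left]
    congr 1; ext k
    simp [mul_assoc]
  · intro c
    have := tsum_of_norm_bounded ((summable_lp1 c).mul_right M).hasSum (hb c)
    rw [tsum_mul_right, ← norm_lp1, mul_comm] at this
    exact this

lemma bounded_of_mult {p : ℝ} (hp : 0 < p) {g : ℂ → ℂ} (hg : DifferentiableOn ℂ g unitDisk)
    (hM : MemMQp p g) : ∃ M : ℝ, ∀ z ∈ unitDisk, ‖g z‖ ≤ M := by
  by_contra hcon
  push Not at hcon
  choose a haD hag using fun n : ℕ => hcon (n : ℝ)
  have ha : ∀ n, ‖a n‖ < 1 := fun n => mem_disk.1 (haD n)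
  have hw : ∀ n, 0 ≤ 1 - ‖a n‖ ^ 2 := fun n => by nlinarith [norm_nonneg (a n), ha n]
  obtain ⟨B, hB⟩ := bloch_of_qp hp hM.1
  have hex := fun n => exists_functional
    (fun k => g (a n) * ((1 - ‖a n‖ ^ 2 : ℝ) : ℂ) * deriv (moebius (a k)) (a n)) ‖g (a n)‖ (by
      intro k
      rw [norm_mul, norm_mul, Complex.norm_real, Real.norm_of_nonneg (hw n), mul_assoc]
      exact mul_le_of_le_one_right (norm_nonneg _) (norm_deriv_moebius_mul_le (ha k) (ha n)))
  choose Λ hΛ using hex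
  obtain ⟨C, hC⟩ := banach_steinhaus (g := Λ) (by
    intro c
    have hc := summable_lp1 c
    obtain ⟨h1, h2, h3⟩ := series_facts hc ha
    obtain ⟨B', hB'⟩ := bloch_of_qp hp (hM.2 _ (qp_series hp hc ha))
    refine ⟨B' + B * ∑' k, ‖c k‖, fun n => ?_⟩
    set f : ℂ → ℂ := fun z => ∑' k, c k * moebius (a k) z with hf
    have e1 : Λ n c = g (a n) * ((1 - ‖a n‖ ^ 2 : ℝ) : ℂ) * deriv f (a n) := by
      rw [hΛ, ← (h2 _ (haD n)).tsum_eq, ← tsum_mul_left]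
      congr 1; ext k; ring
    have hdg : DifferentiableAt ℂ g (a n) := hg.differentiableAt (isOpen_disk.mem_nhds (haD n))
    have hdf : DifferentiableAt ℂ f (a n) := h1.differentiableAt (isOpen_disk.mem_nhds (haD n))
    have e2 : deriv (fun z => g z * f z) (a n) = deriv g (a n) * f (a n) + g (a n) * deriv f (a n) :=
      deriv_fun_mul hdg hdf
    have e3 : Λ n c = ((1 - ‖a n‖ ^ 2 : ℝ) : ℂ) * deriv (fun z => g z * f z) (a n) -
        ((1 - ‖a n‖ ^ 2 : ℝ) : ℂ) * deriv g (a n) * f (a n) := by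
      rw [e1, e2]; ring
    rw [e3]
    refine (norm_sub_le _ _).trans ?_
    rw [norm_mul, norm_mul, norm_mul, Complex.norm_real, Real.norm_of_nonneg (hw n)]
    refine add_le_add (hB' _ (haD n)) ?_
    have hb := hB _ (haD n)
    have hn : 0 ≤ (1 - ‖a n‖ ^ 2) * ‖deriv g (a n)‖ := mul_nonneg (hw n) (norm_nonneg _)
    exact mul_le_mul hb (h3 _ (haD n)) (norm_nonneg _) (hn.trans hb))
  obtain ⟨n, hn⟩ := exists_nat_gt C
  have h1 := (Λ n).le_of_opNorm_le (hC n) (lp.single 1 n (1 : ℂ))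
  rw [lp.norm_single (by simp), hΛ, tsum_eq_single n (by
    intro k hk
    rw [lp.single_apply_ne _ _ _ hk, zero_mul]), lp.single_apply_self] at h1
  rw [one_mul, norm_mul, norm_mul, Complex.norm_real, Real.norm_of_nonneg (hw n), mul_assoc,
    deriv_moebius_self (ha n)] at h1
  simp only [norm_one, mul_one] at h1
  linarith [hag n]

lemma measurable_den (a : ℂ) : Measurable fun z : ℂ => ‖1 - (starRingEnd ℂ) a * z‖ := by
  fun_prop

lemma diskMeasure_apply (w : ℂ → ℝ) (s : Set ℂ) :
    diskMeasure w s = ∫⁻ z in s ∩ unitDisk, ENNReal.ofReal (w z) := by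
  rw [diskMeasure, withDensity_apply', Measure.restrict_restrict' measurableSet_disk]

lemma carleson_of_integral {p : ℝ} (hp : 0 < p) {W : ℂ → ℝ} (hW : ∀ z, 0 ≤ W z) {C : ℝ}
    (hC : ∀ a ∈ unitDisk,
      ∫⁻ z in unitDisk, ENNReal.ofReal (W z * (1 - ‖moebius a z‖ ^ 2) ^ p) ≤ ENNReal.ofReal C) :
    IsPCarleson p (diskMeasure fun z => W z * (1 - ‖z‖ ^ 2) ^ p) := by
  refine ⟨36 ^ p * max C 0, fun θ h hh => ?_⟩
  obtain ⟨hh0, hh1⟩ := hh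
  set a : ℂ := ((1 - h : ℝ) : ℂ) * Complex.exp (Complex.I * θ) with ha
  have hna : ‖a‖ = 1 - h := by
    rw [ha, norm_mul, mul_comm Complex.I, Complex.norm_exp_ofReal_mul_I, Complex.norm_real,
      Real.norm_of_nonneg (by linarith), mul_one]
  have ha1 : ‖a‖ < 1 := by linarith
  set E : Set ℂ := {z | ‖1 - (starRingEnd ℂ) a * z‖ ≤ 6 * h} with hE
  have hEm : MeasurableSet E := measurableSet_le (measurable_den a) measurable_const
  have hsub : carlesonBox θ h ⊆ E := by
    rintro z ⟨hz1, hz2, t, ht, hzt⟩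
    have e : 1 - (starRingEnd ℂ) a * z = ((1 - (1 - h) * ‖z‖ : ℝ) : ℂ) -
        (((1 - h) * ‖z‖ : ℝ) : ℂ) * (Complex.exp (Complex.I * ((t - θ : ℝ) : ℂ)) - 1) := by
      have e1 : (starRingEnd ℂ) a = ((1 - h : ℝ) : ℂ) * Complex.exp (-(Complex.I * θ)) := by
        rw [ha, map_mul, Complex.conj_ofReal, ← Complex.exp_conj, map_mul, Complex.conj_I,
          Complex.conj_ofReal, neg_mul]
      have e2 : Complex.exp (Complex.I * ((t - θ : ℝ) : ℂ)) =
          Complex.exp (-(Complex.I * θ)) * Complex.exp (Complex.I * t) := by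
        rw [← Complex.exp_add]; congr 1; push_cast; ring
      rw [e1, e2]
      conv_lhs => rw [hzt]
      push_cast; ring
    show ‖1 - (starRingEnd ℂ) a * z‖ ≤ 6 * h
    rw [e]
    refine (norm_sub_le _ _).trans ?_
    have h0 := norm_nonneg z
    have h1 : 0 ≤ (1 - h) * ‖z‖ := mul_nonneg (by linarith) h0
    have h2 : (1 - h) * ‖z‖ ≤ 1 := by nlinarith
    rw [norm_mul, Complex.norm_real, Complex.norm_real, Real.norm_of_nonneg h1,
      Real.norm_of_nonneg (by linarith)]
    have h3 : ‖Complex.exp (Complex.I * ((t - θ : ℝ) : ℂ)) - 1‖ ≤ Real.pi * h := by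
      refine (Real.norm_exp_I_mul_ofReal_sub_one_le).trans ?_
      rw [Real.norm_eq_abs]; exact ht.le
    have h4 : (1 - h) * ‖z‖ * ‖Complex.exp (Complex.I * ((t - θ : ℝ) : ℂ)) - 1‖ ≤ Real.pi * h := by
      refine (mul_le_of_le_one_left (norm_nonneg _) h2).trans h3
    have h5 : Real.pi * h ≤ 4 * h := mul_le_mul_of_nonneg_right Real.pi_le_four hh0.le
    nlinarith
  have hpt : ∀ z ∈ E ∩ unitDisk, ENNReal.ofReal (W z * (1 - ‖z‖ ^ 2) ^ p) ≤
      ENNReal.ofReal ((36 * h) ^ p) * ENNReal.ofReal (W z * (1 - ‖moebius a z‖ ^ 2) ^ p) := by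
    rintro z ⟨hz, hzD⟩
    have hz1 := mem_disk.1 hzD
    rw [← ENNReal.ofReal_mul (by positivity)]
    refine ENNReal.ofReal_le_ofReal ?_
    rw [mul_left_comm, ← Real.mul_rpow (by positivity) (one_sub_moebius_nonneg ha1 hz1)]
    refine mul_le_mul_of_nonneg_left (Real.rpow_le_rpow ?_ ?_ hp.le) (hW z)
    · nlinarith [norm_nonneg z]
    · rw [one_sub_moebius ha1 hz1]
      have hden := norm_den_pos ha1 hz1
      rw [← mul_div_assoc, le_div_iff₀ (by positivity)]
      have h1 : ‖1 - (starRingEnd ℂ) a * z‖ ^ 2 ≤ (6 * h) ^ 2 := by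
        have : ‖1 - (starRingEnd ℂ) a * z‖ ≤ 6 * h := hz
        gcongr
      have h2 : h ≤ 1 - ‖a‖ ^ 2 := by rw [hna]; nlinarith
      have h3 : 0 ≤ 1 - ‖z‖ ^ 2 := by nlinarith [norm_nonneg z]
      calc (1 - ‖z‖ ^ 2) * ‖1 - (starRingEnd ℂ) a * z‖ ^ 2 ≤ (1 - ‖z‖ ^ 2) * (6 * h) ^ 2 := by
            gcongr
        _ = 36 * h * (h * (1 - ‖z‖ ^ 2)) := by ring
        _ ≤ _ := by gcongr
  calc (diskMeasure fun z => W z * (1 - ‖z‖ ^ 2) ^ p) (carlesonBox θ h)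
      ≤ (diskMeasure fun z => W z * (1 - ‖z‖ ^ 2) ^ p) E := measure_mono hsub
    _ = ∫⁻ z in E ∩ unitDisk, ENNReal.ofReal (W z * (1 - ‖z‖ ^ 2) ^ p) := diskMeasure_apply _ _
    _ ≤ ∫⁻ z in E ∩ unitDisk, ENNReal.ofReal ((36 * h) ^ p) *
          ENNReal.ofReal (W z * (1 - ‖moebius a z‖ ^ 2) ^ p) :=
        setLIntegral_mono' (hEm.inter measurableSet_disk) hpt
    _ = ENNReal.ofReal ((36 * h) ^ p) * ∫⁻ z in E ∩ unitDisk,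
          ENNReal.ofReal (W z * (1 - ‖moebius a z‖ ^ 2) ^ p) :=
        lintegral_const_mul' _ _ ENNReal.ofReal_ne_top
    _ ≤ ENNReal.ofReal ((36 * h) ^ p) * ENNReal.ofReal (max C 0) := by
        gcongr
        refine (lintegral_mono_set Set.inter_subset_right).trans ((hC a (mem_disk.2 ha1)).trans ?_)
        exact ENNReal.ofReal_le_ofReal (le_max_left _ _)
    _ = ENNReal.ofReal (36 ^ p * max C 0 * h ^ p) := by
        rw [← ENNReal.ofReal_mul (by positivity), Real.mul_rpow (by norm_num) hh0.le]
        congr 1; ring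

lemma mem_box_of_den {a z : ℂ} (ha : ‖a‖ < 1) (hz : ‖z‖ < 1) {h : ℝ} (hh1 : h ≤ 1)
    (hd : 2 * ‖1 - (starRingEnd ℂ) a * z‖ < h) : z ∈ carlesonBox (Complex.arg a) h := by
  set ρ := ‖1 - (starRingEnd ℂ) a * z‖ with hρ
  have hρ0 : 0 ≤ ρ := norm_nonneg _
  have hz' := norm_den_ge' (z := z) ha
  set v : ℂ := (starRingEnd ℂ) a * z with hv
  set u : ℝ := Complex.arg v with hu
  have hvn : ‖v‖ = ‖a‖ * ‖z‖ := by rw [hv, norm_mul, Complex.norm_conj]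
  have hr : 1 / 2 ≤ ‖v‖ := by
    have := norm_sub_norm_le (1 : ℂ) v
    rw [norm_one] at this
    linarith
  have hv0 : v ≠ 0 := by
    rw [← norm_pos_iff]; linarith
  have ha0 : a ≠ 0 := by rintro rfl; simp [hv] at hv0
  have hz0 : z ≠ 0 := by rintro rfl; simp [hv] at hv0
  refine ⟨by linarith, hz, Complex.arg a + u, ?_, ?_⟩
  · rw [add_sub_cancel_left]
    have hpi := Real.pi_pos
    have habs : |u| ≤ Real.pi := Complex.abs_arg_le_pi v
    have hcos := Real.cos_le_one_sub_mul_cos_sq habs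
    have hsq : ρ ^ 2 = (1 - ‖v‖) ^ 2 + 2 * ‖v‖ * (1 - Real.cos u) := by
      have hre : v.re = ‖v‖ * Real.cos u := (Complex.norm_mul_cos_arg v).symm
      have h1 : ρ ^ 2 = (1 - v.re) ^ 2 + v.im ^ 2 := by
        rw [hρ, ← Complex.normSq_eq_norm_sq, Complex.normSq_apply]; simp; ring
      have h2 : ‖v‖ ^ 2 = v.re ^ 2 + v.im ^ 2 := by
        rw [← Complex.normSq_eq_norm_sq, Complex.normSq_apply]; ring
      have h3 : v.im ^ 2 = ‖v‖ ^ 2 - v.re ^ 2 := by linarith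
      rw [h1, h3, hre]; ring
    have h2 : 2 / Real.pi ^ 2 * u ^ 2 ≤ ρ ^ 2 := by
      have h3 : 0 ≤ 2 / Real.pi ^ 2 * u ^ 2 := by positivity
      nlinarith [sq_nonneg (1 - ‖v‖)]
    have h3 : u ^ 2 ≤ (Real.pi * ρ) ^ 2 := by
      rw [div_mul_eq_mul_div, div_le_iff₀ (by positivity)] at h2
      nlinarith [sq_nonneg u]
    have h4 : |u| ≤ Real.pi * ρ := abs_le_of_sq_le_sq h3 (by positivity)
    nlinarith
  · have e1 : a = ‖a‖ * Complex.exp (Complex.arg a * Complex.I) :=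
      (Complex.norm_mul_exp_arg_mul_I a).symm
    have e2 : v = ‖v‖ * Complex.exp (u * Complex.I) := (Complex.norm_mul_exp_arg_mul_I v).symm
    have hca : (starRingEnd ℂ) a ≠ 0 := by simpa using ha0
    have hna : (‖a‖ : ℂ) ≠ 0 := by simpa using ha0
    apply mul_left_cancel₀ hca
    have e3 : (starRingEnd ℂ) a * Complex.exp (Complex.arg a * Complex.I) = ‖a‖ := by
      have h1 : (starRingEnd ℂ) a * a = (‖a‖ : ℂ) ^ 2 := Complex.conj_mul' a
      apply mul_left_cancel₀ hna
      calc (‖a‖ : ℂ) * ((starRingEnd ℂ) a * Complex.exp (Complex.arg a * Complex.I))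
          = (starRingEnd ℂ) a * (‖a‖ * Complex.exp (Complex.arg a * Complex.I)) := by ring
        _ = ‖a‖ * ‖a‖ := by rw [← e1, h1]; ring
    calc (starRingEnd ℂ) a * z = ‖v‖ * Complex.exp (u * Complex.I) := e2
      _ = (‖a‖ * ‖z‖) * Complex.exp (u * Complex.I) := by rw [hvn]; push_cast; ring
      _ = ((starRingEnd ℂ) a * Complex.exp (Complex.arg a * Complex.I)) * ‖z‖ *
            Complex.exp (u * Complex.I) := by rw [e3]
      _ = (starRingEnd ℂ) a * (‖z‖ * (Complex.exp (Complex.arg a * Complex.I) *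
            Complex.exp (u * Complex.I))) := by ring
      _ = _ := by
        rw [← Complex.exp_add]
        congr 3
        push_cast; ring

lemma disk_subset_boxes : unitDisk ⊆ carlesonBox 0 1 ∪ carlesonBox Real.pi 1 ∪ {0} := by
  intro z hz
  have hz1 := mem_disk.1 hz
  by_cases h0 : z = 0
  · right; exact h0
  left
  have hpos : 1 - (1 : ℝ) < ‖z‖ := by simpa using h0
  have e : z = ‖z‖ * Complex.exp (Complex.I * (Complex.arg z : ℝ)) := by
    rw [mul_comm Complex.I]; exact (Complex.norm_mul_exp_arg_mul_I z).symm
  rcases lt_or_eq_of_le (Complex.abs_arg_le_pi z) with h | h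
  · left
    exact ⟨hpos, hz1, Complex.arg z, by simpa using h, e⟩
  · right
    have h1 : Complex.arg z = Real.pi := by
      rcases abs_eq Real.pi_pos.le |>.1 h with h2 | h2
      · exact h2
      · exact absurd h2 (Complex.neg_pi_lt_arg z).ne'
    exact ⟨hpos, hz1, Complex.arg z, by rw [h1]; simp [Real.pi_pos], e⟩

lemma integral_of_carleson {p : ℝ} (hp : 0 < p) {W : ℂ → ℝ} (hW : ∀ z, 0 ≤ W z)
    (hWm : AEMeasurable W (volume.restrict unitDisk))
    (hC : IsPCarleson p (diskMeasure fun z => W z * (1 - ‖z‖ ^ 2) ^ p)) :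
    ∃ C : ℝ, ∀ a ∈ unitDisk,
      ∫⁻ z in unitDisk, ENNReal.ofReal (W z * (1 - ‖moebius a z‖ ^ 2) ^ p) ≤ ENNReal.ofReal C := by
  obtain ⟨C₁, hC₁⟩ := hC
  set w : ℂ → ℝ := fun z => W z * (1 - ‖z‖ ^ 2) ^ p with hw
  set μ := diskMeasure w with hμ
  set C : ℝ := max C₁ 0 with hCdef
  have hC0 : 0 ≤ C := le_max_right _ _
  have hbox : ∀ θ : ℝ, ∀ h ∈ Set.Ioc (0 : ℝ) 1, μ (carlesonBox θ h) ≤ ENNReal.ofReal (C * h ^ p) := by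
    intro θ h hh
    refine (hC₁ θ h hh).trans (ENNReal.ofReal_le_ofReal ?_)
    exact mul_le_mul_of_nonneg_right (le_max_left _ _) (Real.rpow_nonneg hh.1.le _)
  have htot : μ unitDisk ≤ ENNReal.ofReal (2 * C) := by
    have h0 : μ {0} = 0 := by
      rw [hμ, diskMeasure_apply]
      refine setLIntegral_measure_zero _ _ (measure_mono_null Set.inter_subset_left ?_)
      simp
    have h1 : ∀ θ : ℝ, μ (carlesonBox θ 1) ≤ ENNReal.ofReal C := by
      intro θ; simpa using hbox θ 1 (by simp)
    calc μ unitDisk ≤ μ (carlesonBox 0 1 ∪ carlesonBox Real.pi 1 ∪ {0}) :=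
          measure_mono disk_subset_boxes
      _ ≤ μ (carlesonBox 0 1) + μ (carlesonBox Real.pi 1) + μ {0} :=
          (measure_union_le _ _).trans (add_le_add_left (measure_union_le _ _) _)
      _ ≤ ENNReal.ofReal C + ENNReal.ofReal C + 0 := by
          rw [h0]; gcongr <;> exact h1 _
      _ = ENNReal.ofReal (2 * C) := by
          rw [add_zero, ← ENNReal.ofReal_add hC0 hC0, two_mul]
  have hwm : AEMeasurable (fun z => ENNReal.ofReal (w z)) (volume.restrict unitDisk) := by
    have : Measurable fun z : ℂ => (1 - ‖z‖ ^ 2) ^ p := by fun_prop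
    exact (hWm.mul this.aemeasurable).ennreal_ofReal
  have hq1 : (2 : ℝ) ^ (-p) < 1 := Real.rpow_lt_one_of_one_lt_of_neg (by norm_num) (by linarith)
  have hq0 : (0 : ℝ) ≤ (2 : ℝ) ^ (-p) := by positivity
  have hsum : Summable fun k : ℕ => (2 * C * 16 ^ p) * ((2 : ℝ) ^ (-p)) ^ k :=
    (summable_geometric_of_lt_one hq0 hq1).mul_left _
  refine ⟨∑' k : ℕ, (2 * C * 16 ^ p) * ((2 : ℝ) ^ (-p)) ^ k, fun a ha => ?_⟩
  have ha1 := mem_disk.1 ha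
  set d : ℝ := 1 - ‖a‖ with hd
  have hd0 : 0 < d := by rw [hd]; linarith
  set E : ℕ → Set ℂ := fun k => {z | ‖1 - (starRingEnd ℂ) a * z‖ < 2 ^ k * d} with hE
  have hEm : ∀ k, MeasurableSet (E k) := fun k =>
    measurableSet_lt (measurable_den a) measurable_const
  have hμE : ∀ k, μ (E k ∩ unitDisk) ≤ ENNReal.ofReal (2 * C * (2 * (2 ^ k * d)) ^ p) := by
    intro k
    by_cases hk : 2 * (2 ^ k * d) ≤ 1
    · calc μ (E k ∩ unitDisk) ≤ μ (carlesonBox (Complex.arg a) (2 * (2 ^ k * d))) := by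
            refine measure_mono ?_
            rintro z ⟨hz, hzD⟩
            have hz' : ‖1 - (starRingEnd ℂ) a * z‖ < 2 ^ k * d := hz
            exact mem_box_of_den ha1 (mem_disk.1 hzD) hk (by linarith)
        _ ≤ ENNReal.ofReal (C * (2 * (2 ^ k * d)) ^ p) := hbox _ _ ⟨by positivity, hk⟩
        _ ≤ _ := by
            refine ENNReal.ofReal_le_ofReal ?_
            gcongr
            linarith
    · refine (measure_mono Set.inter_subset_right).trans (htot.trans ?_)
      refine ENNReal.ofReal_le_ofReal ?_
      have : 1 ≤ (2 * (2 ^ k * d)) ^ p := Real.one_le_rpow (by linarith) hp.le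
      nlinarith
  set B : ℕ → ℝ := fun k => (8 / (4 ^ k * d)) ^ p with hB
  have hB0 : ∀ k, 0 ≤ B k := fun k => by rw [hB]; positivity
  have hpt : ∀ z ∈ unitDisk, ENNReal.ofReal (W z * (1 - ‖moebius a z‖ ^ 2) ^ p) ≤
      ∑' k, ENNReal.ofReal (B k) * (E k).indicator (fun z => ENNReal.ofReal (w z)) z := by
    intro z hzD
    have hz1 := mem_disk.1 hzD
    set ρ := ‖1 - (starRingEnd ℂ) a * z‖ with hρ
    have hρd : d ≤ ρ := norm_den_ge hz1
    have hρ0 : 0 < ρ := lt_of_lt_of_le hd0 hρd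
    have hex : ∃ k : ℕ, ρ < 2 ^ k * d := by
      obtain ⟨k, hk⟩ := pow_unbounded_of_one_lt (ρ / d) (one_lt_two)
      exact ⟨k, (div_lt_iff₀ hd0).1 hk⟩
    classical
    obtain ⟨k, hk, hmin⟩ : ∃ k : ℕ, ρ < 2 ^ (k + 1) * d ∧ 2 ^ k * d ≤ ρ := by
      have h1 := Nat.find_spec hex
      have h2 := fun m => Nat.find_min (m := m) hex
      rcases hn : Nat.find hex with _ | k
      · rw [hn] at h1; simp at h1; linarith
      · rw [hn] at h1
        exact ⟨k, h1, not_lt.1 (h2 k (by omega))⟩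
    refine le_trans ?_ (ENNReal.le_tsum (k + 1))
    have hmem : z ∈ E (k + 1) := hk
    rw [Set.indicator_of_mem hmem, ← ENNReal.ofReal_mul (hB0 _)]
    refine ENNReal.ofReal_le_ofReal ?_
    have hz2 : 0 ≤ 1 - ‖z‖ ^ 2 := by nlinarith [norm_nonneg z]
    rw [hw, hB]
    simp only
    rw [mul_left_comm, ← Real.mul_rpow (by positivity) hz2]
    refine mul_le_mul_of_nonneg_left (Real.rpow_le_rpow (one_sub_moebius_nonneg ha1 hz1) ?_ hp.le)
      (hW z)
    rw [one_sub_moebius ha1 hz1, ← hρ]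
    have h1 : 1 - ‖a‖ ^ 2 ≤ 2 * d := by rw [hd]; nlinarith [norm_nonneg a]
    have h2 : (2 ^ k * d) ^ 2 ≤ ρ ^ 2 := by gcongr
    calc (1 - ‖a‖ ^ 2) * (1 - ‖z‖ ^ 2) / ρ ^ 2 ≤ (2 * d) * (1 - ‖z‖ ^ 2) / (2 ^ k * d) ^ 2 := by
          gcongr
      _ = 8 / (4 ^ (k + 1) * d) * (1 - ‖z‖ ^ 2) := by
          have : (4 : ℝ) ^ k = (2 ^ k) ^ 2 := by rw [← pow_mul, mul_comm, pow_mul]; norm_num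
          rw [pow_succ (4 : ℝ) k, this]
          field_simp
          ring
  calc ∫⁻ z in unitDisk, ENNReal.ofReal (W z * (1 - ‖moebius a z‖ ^ 2) ^ p)
      ≤ ∫⁻ z in unitDisk, ∑' k, ENNReal.ofReal (B k) *
          (E k).indicator (fun z => ENNReal.ofReal (w z)) z :=
        setLIntegral_mono' measurableSet_disk hpt
    _ = ∑' k, ENNReal.ofReal (B k) * μ (E k ∩ unitDisk) := by
        rw [lintegral_tsum (fun k => (hwm.indicator (hEm k)).const_mul _)]
        congr 1
        ext k
        rw [lintegral_const_mul' _ _ ENNReal.ofReal_ne_top, lintegral_indicator (hEm k),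
          Measure.restrict_restrict (hEm k), hμ, diskMeasure_apply, Set.inter_assoc,
          Set.inter_self]
    _ ≤ ∑' k, ENNReal.ofReal (B k) * ENNReal.ofReal (2 * C * (2 * (2 ^ k * d)) ^ p) := by
        gcongr with k
        exact hμE k
    _ = ∑' k : ℕ, ENNReal.ofReal ((2 * C * 16 ^ p) * ((2 : ℝ) ^ (-p)) ^ k) := by
        congr 1
        ext k
        rw [← ENNReal.ofReal_mul (hB0 k)]
        congr 1
        have e1 : ((2 : ℝ) ^ (-p)) ^ k = ((2 : ℝ) ^ k)⁻¹ ^ p := by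
          rw [← Real.rpow_natCast, ← Real.rpow_mul (by norm_num), ← Real.rpow_natCast,
            ← Real.rpow_neg (by norm_num), ← Real.rpow_mul (by norm_num)]
          congr 1; ring
        rw [hB, e1, mul_left_comm, mul_assoc (2 * C), ← Real.mul_rpow (by positivity) (by positivity),
          ← Real.mul_rpow (by positivity) (by positivity)]
        congr 2
        have : (4 : ℝ) ^ k = (2 ^ k) ^ 2 := by rw [← pow_mul, mul_comm, pow_mul]; norm_num
        rw [this]
        field_simp
        norm_num
    _ = ENNReal.ofReal (∑' k : ℕ, (2 * C * 16 ^ p) * ((2 : ℝ) ^ (-p)) ^ k) :=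
        (ENNReal.ofReal_tsum_of_nonneg (fun k => by positivity) hsum).symm

lemma sq_norm_add_le (x y : ℂ) : ‖x + y‖ ^ 2 ≤ 2 * ‖x‖ ^ 2 + 2 * ‖y‖ ^ 2 := by
  have h1 : ‖x + y‖ ^ 2 ≤ (‖x‖ + ‖y‖) ^ 2 := by
    have := norm_add_le x y
    gcongr
  nlinarith [sq_nonneg (‖x‖ - ‖y‖)]

lemma h2Bounded_mul {g f : ℂ → ℂ} {M : ℝ} (hg : DifferentiableOn ℂ g unitDisk)
    (hf : DifferentiableOn ℂ f unitDisk) (hM : ∀ z ∈ unitDisk, ‖g z‖ ≤ M) (h : h2Bounded f) :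
    h2Bounded (fun z => g z * f z) := by
  obtain ⟨C, hC⟩ := h
  refine ⟨M ^ 2 * C, fun r hr => ?_⟩
  have hz : ∀ t : ℝ, (r : ℂ) * Complex.exp (Complex.I * t) ∈ unitDisk := by
    intro t
    rw [mem_disk, norm_mul, mul_comm Complex.I, Complex.norm_exp_ofReal_mul_I, Complex.norm_real,
      Real.norm_of_nonneg hr.1, mul_one]
    exact hr.2
  have hc : Continuous fun t : ℝ => (r : ℂ) * Complex.exp (Complex.I * t) := by fun_prop
  have hcf : Continuous fun t : ℝ => f ((r : ℂ) * Complex.exp (Complex.I * t)) :=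
    hf.continuousOn.comp_continuous hc hz
  have hcg : Continuous fun t : ℝ => g ((r : ℂ) * Complex.exp (Complex.I * t)) :=
    hg.continuousOn.comp_continuous hc hz
  calc (∫ t in (0 : ℝ)..(2 * Real.pi), ‖g ((r : ℂ) * Complex.exp (Complex.I * t)) *
        f ((r : ℂ) * Complex.exp (Complex.I * t))‖ ^ 2)
      ≤ ∫ t in (0 : ℝ)..(2 * Real.pi),
        M ^ 2 * ‖f ((r : ℂ) * Complex.exp (Complex.I * t))‖ ^ 2 := by
        refine intervalIntegral.integral_mono_on (by positivity)
          (Continuous.intervalIntegrable ((hcg.mul hcf).norm.pow 2) _ _)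
          (Continuous.intervalIntegrable (continuous_const.mul (hcf.norm.pow 2)) _ _) fun t _ => ?_
        rw [norm_mul, mul_pow]
        have := hM _ (hz t)
        gcongr
    _ = M ^ 2 * ∫ t in (0 : ℝ)..(2 * Real.pi), ‖f ((r : ℂ) * Complex.exp (Complex.I * t))‖ ^ 2 :=
        intervalIntegral.integral_const_mul _ _
    _ ≤ M ^ 2 * C := by
        have := hC r hr
        gcongr

lemma memQp_one (p : ℝ) : MemQp p (fun _ => 1) := by
  refine ⟨differentiableOn_const _, h2Bounded_of_bdd (M := 1) (by simp), 0, fun a _ => ?_⟩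
  simp [qpIntegral]

lemma deriv_mul_disk {g f : ℂ → ℂ} (hg : DifferentiableOn ℂ g unitDisk)
    (hf : DifferentiableOn ℂ f unitDisk) {z : ℂ} (hz : z ∈ unitDisk) :
    deriv (fun z => g z * f z) z = f z * deriv g z + g z * deriv f z := by
  rw [deriv_fun_mul (hg.differentiableAt (isOpen_disk.mem_nhds hz))
    (hf.differentiableAt (isOpen_disk.mem_nhds hz)), mul_comm (f z)]

lemma qp_const_bound {p : ℝ} {f : ℂ → ℂ} {a : ℂ} {C K : ℝ} (hK : 0 ≤ K)
    (h : qpIntegral p f a ≤ ENNReal.ofReal C) :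
    ∫⁻ z in unitDisk, ENNReal.ofReal K *
      ENNReal.ofReal (‖deriv f z‖ ^ 2 * (1 - ‖moebius a z‖ ^ 2) ^ p) ≤
      ENNReal.ofReal (K * max C 0) := by
  rw [lintegral_const_mul' _ _ ENNReal.ofReal_ne_top, ENNReal.ofReal_mul hK]
  gcongr
  exact h.trans (ENNReal.ofReal_le_ofReal (le_max_left _ _))

lemma forward {p : ℝ} (hp : 0 < p) {g : ℂ → ℂ} (hg : DifferentiableOn ℂ g unitDisk)
    {M : ℝ} (hM : ∀ z ∈ unitDisk, ‖g z‖ ≤ M) {f : ℂ → ℂ} (hf : MemQp p f)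
    (hgf : MemQp p (fun z => g z * f z)) :
    IsPCarleson p
      (diskMeasure fun z => ‖f z‖ ^ 2 * ‖deriv g z‖ ^ 2 * (1 - ‖z‖ ^ 2) ^ p) := by
  obtain ⟨hfd, -, C₁, hC₁⟩ := hf
  obtain ⟨-, -, C₂, hC₂⟩ := hgf
  refine carleson_of_integral hp (W := fun z => ‖f z‖ ^ 2 * ‖deriv g z‖ ^ 2)
    (C := 2 * max C₂ 0 + 2 * M ^ 2 * max C₁ 0) (fun z => by positivity) fun a ha => ?_
  have ha1 := mem_disk.1 ha
  rw [ENNReal.ofReal_add (by positivity) (by positivity)]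
  refine le_trans ?_ (add_le_add (qp_const_bound (by norm_num) (hC₂ a ha))
    (qp_const_bound (by positivity) (hC₁ a ha)))
  rw [← lintegral_add_left ((measurable_qp p _ a).const_mul _)]
  refine setLIntegral_mono' measurableSet_disk fun z hz => ?_
  have hw : 0 ≤ (1 - ‖moebius a z‖ ^ 2) ^ p :=
    Real.rpow_nonneg (one_sub_moebius_nonneg ha1 (mem_disk.1 hz)) _
  rw [← ENNReal.ofReal_mul (by norm_num), ← ENNReal.ofReal_mul (by positivity),
    ← ENNReal.ofReal_add (by positivity) (by positivity)]
  refine ENNReal.ofReal_le_ofReal ?_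
  have e : f z * deriv g z = deriv (fun z => g z * f z) z + -(g z * deriv f z) := by
    rw [deriv_mul_disk hg hfd hz]; ring
  have h1 := sq_norm_add_le (deriv (fun z => g z * f z) z) (-(g z * deriv f z))
  rw [← e, norm_neg, norm_mul, norm_mul, mul_pow, mul_pow] at h1
  have h2 : ‖g z‖ ^ 2 * ‖deriv f z‖ ^ 2 ≤ M ^ 2 * ‖deriv f z‖ ^ 2 := by
    have := hM z hz
    gcongr
  have h3 : ‖f z‖ ^ 2 * ‖deriv g z‖ ^ 2 ≤
      2 * ‖deriv (fun z => g z * f z) z‖ ^ 2 + 2 * M ^ 2 * ‖deriv f z‖ ^ 2 := by linarith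
  calc _ ≤ (2 * ‖deriv (fun z => g z * f z) z‖ ^ 2 + 2 * M ^ 2 * ‖deriv f z‖ ^ 2) *
        (1 - ‖moebius a z‖ ^ 2) ^ p := mul_le_mul_of_nonneg_right h3 hw
    _ = _ := by ring

lemma backward {p : ℝ} (hp : 0 < p) {g : ℂ → ℂ} (hg : DifferentiableOn ℂ g unitDisk)
    {M : ℝ} (hM : ∀ z ∈ unitDisk, ‖g z‖ ≤ M) {f : ℂ → ℂ} (hf : MemQp p f)
    (hc : IsPCarleson p
      (diskMeasure fun z => ‖f z‖ ^ 2 * ‖deriv g z‖ ^ 2 * (1 - ‖z‖ ^ 2) ^ p)) :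
    MemQp p (fun z => g z * f z) := by
  obtain ⟨hfd, hf2, C₁, hC₁⟩ := hf
  refine ⟨hg.mul hfd, h2Bounded_mul hg hfd hM hf2, ?_⟩
  have hm : AEMeasurable (fun z => ‖f z‖ ^ 2 * ‖deriv g z‖ ^ 2) (volume.restrict unitDisk) := by
    have h1 := hfd.continuousOn.aemeasurable (μ := volume) measurableSet_disk
    have h2 := (measurable_deriv g).aemeasurable (μ := volume.restrict unitDisk)
    exact (h1.norm.pow_const 2).mul (h2.norm.pow_const 2)
  obtain ⟨C₂, hC₂⟩ := integral_of_carleson hp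
    (W := fun z => ‖f z‖ ^ 2 * ‖deriv g z‖ ^ 2) (fun z => by positivity) hm hc
  refine ⟨2 * M ^ 2 * max C₁ 0 + 2 * max C₂ 0, fun a ha => ?_⟩
  have ha1 := mem_disk.1 ha
  have h4 : ∫⁻ z in unitDisk, ENNReal.ofReal 2 *
      ENNReal.ofReal (‖f z‖ ^ 2 * ‖deriv g z‖ ^ 2 * (1 - ‖moebius a z‖ ^ 2) ^ p) ≤
      ENNReal.ofReal (2 * max C₂ 0) := by
    rw [lintegral_const_mul' _ _ ENNReal.ofReal_ne_top, ENNReal.ofReal_mul (by norm_num)]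
    gcongr
    exact (hC₂ a ha).trans (ENNReal.ofReal_le_ofReal (le_max_left _ _))
  rw [ENNReal.ofReal_add (by positivity) (by positivity)]
  refine le_trans ?_ (add_le_add (qp_const_bound (by positivity) (hC₁ a ha)) h4)
  rw [← lintegral_add_left ((measurable_qp p _ a).const_mul _)]
  refine setLIntegral_mono' measurableSet_disk fun z hz => ?_
  have hw : 0 ≤ (1 - ‖moebius a z‖ ^ 2) ^ p :=
    Real.rpow_nonneg (one_sub_moebius_nonneg ha1 (mem_disk.1 hz)) _
  rw [← ENNReal.ofReal_mul (by positivity), ← ENNReal.ofReal_mul (by norm_num),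
    ← ENNReal.ofReal_add (by positivity) (by positivity)]
  refine ENNReal.ofReal_le_ofReal ?_
  have h1 := sq_norm_add_le (f z * deriv g z) (g z * deriv f z)
  rw [← deriv_mul_disk hg hfd hz, norm_mul, norm_mul, mul_pow, mul_pow] at h1
  have h2 : ‖g z‖ ^ 2 * ‖deriv f z‖ ^ 2 ≤ M ^ 2 * ‖deriv f z‖ ^ 2 := by
    have := hM z hz
    gcongr
  have h3 : ‖deriv (fun z => g z * f z) z‖ ^ 2 ≤
      2 * M ^ 2 * ‖deriv f z‖ ^ 2 + 2 * (‖f z‖ ^ 2 * ‖deriv g z‖ ^ 2) := by linarith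
  calc _ ≤ (2 * M ^ 2 * ‖deriv f z‖ ^ 2 + 2 * (‖f z‖ ^ 2 * ‖deriv g z‖ ^ 2)) *
        (1 - ‖moebius a z‖ ^ 2) ^ p := mul_le_mul_of_nonneg_right h3 hw
    _ = _ := by ring

/-- For `p > 0`, an analytic function `g` on the unit disk belongs to `M(Q_p)` if and only
if `g ∈ H^∞(𝔻)` and for every `f ∈ Q_p` the measure `|f(z)|² |g'(z)|² (1-|z|²)^p dA(z)`
is a `p`-Carleson measure. -/
theorem memMQp_iff (p : ℝ) (hp : 0 < p) (g : ℂ → ℂ)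
    (hg : DifferentiableOn ℂ g unitDisk) :
    MemMQp p g ↔
      (MemHinf g ∧ ∀ f : ℂ → ℂ, MemQp p f →
        IsPCarleson p
          (diskMeasure fun z => ‖f z‖ ^ 2 * ‖deriv g z‖ ^ 2 * (1 - ‖z‖ ^ 2) ^ p)) := by
  constructor
  · intro hM
    obtain ⟨M, hb⟩ := bounded_of_mult hp hg hM
    exact ⟨⟨hg, M, hb⟩, fun f hf => forward hp hg hb hf (hM.2 f hf)⟩
  · rintro ⟨⟨-, M, hb⟩, hc⟩
    have h := fun f hf => backward hp hg hb hf (hc f hf)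
    refine ⟨?_, h⟩
    simpa using h _ (memQp_one p)

end
end
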